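/- arXiv:1602.02235 — 15 statements merged into one kernel-verified Lean document; each statement's English description precedes it below -/
import Mathlib

section
/- Let q be a prime power and let n be a positive integer dividing q^2+1. Let δ be an integer with 1 ≤ δ ≤ ⌊n/(q+1)⌋, and let Z = {0} ∪ {i mod n, −i mod n : 1 ≤ i ≤ δ} ⊆ ℤ/nℤ. Then Z ∩ {−q·z : z ∈ Z} = {0}; in particular, the subset Z₁ = Z \ {0} satisfies Z₁ ∩ {−q·z : z ∈ Z₁} = ∅. -/
theorem core_aux (q n δ : ℕ) (hq : 2 ≤ q) (hdvd : n ∣ q ^ 2 + 1)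
    (hδ : δ * (q + 1) ≤ n) (a b : ℤ) (ha1 : -(δ : ℤ) ≤ a) (ha2 : a ≤ δ)
    (hb1 : -(δ : ℤ) ≤ b) (hb2 : b ≤ δ) (h : (n : ℤ) ∣ a + q * b) (hδ1 : 1 ≤ δ) : a = 0 := by
  have hnle : n ≤ q ^ 2 + 1 := Nat.le_of_dvd (by positivity) hdvd
  have hδq : δ < q := by
    by_contra hc
    push Not at hc
    nlinarith [Nat.mul_le_mul_right (q + 1) hc]
  have hne : δ * (q + 1) ≠ n := by
    intro he
    have h1 : q + 1 ∣ q ^ 2 + 1 := (Dvd.intro_left δ he).trans hdvd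
    have h2 : ((q : ℤ) + 1) ∣ (q : ℤ) ^ 2 + 1 := by exact_mod_cast h1
    have h3 : ((q : ℤ) + 1) ∣ 2 := by
      have : (2 : ℤ) = ((q : ℤ) ^ 2 + 1) - (q + 1) * (q - 1) := by ring
      rw [this]
      exact dvd_sub h2 (Dvd.intro _ rfl)
    have := Int.le_of_dvd (by norm_num) h3
    omega
  have hlt : (δ : ℤ) * (q + 1) < n := by exact_mod_cast lt_of_le_of_ne hδ hne
  have hq0 : (0 : ℤ) ≤ q := by positivity
  have hz : a + q * b = 0 := by
    apply Int.eq_zero_of_abs_lt_dvd h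
    rw [abs_lt]
    constructor <;> nlinarith
  have hb : b = 0 := by
    rcases lt_trichotomy b 0 with hb | hb | hb
    · nlinarith
    · exact hb
    · nlinarith
  subst hb
  simpa using hz

/-- Let `q` be a prime power, `n ∣ q² + 1` positive, `1 ≤ δ ≤ ⌊n/(q+1)⌋`,
and `Z = {0} ∪ {±i mod n : 1 ≤ i ≤ δ} ⊆ ℤ/nℤ` (the image of `[-δ, δ]`).
Then `Z ∩ (-q)·Z = {0}`, and `Z₁ = Z \ {0}` satisfies `Z₁ ∩ (-q)·Z₁ = ∅`. -/
theorem stmt0 (q n : ℕ) (hq : IsPrimePow q) (hn : 0 < n) (hdvd : n ∣ q ^ 2 + 1)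
    (δ : ℕ) (hδ1 : 1 ≤ δ) (hδ2 : δ ≤ n / (q + 1))
    (Z : Finset (ZMod n))
    (hZ : Z = (Finset.Icc (-(δ : ℤ)) (δ : ℤ)).image (fun (i : ℤ) => (i : ZMod n))) :
    Z ∩ Z.image (fun z => -(q : ZMod n) * z) = {0} ∧
    (Z \ {0}) ∩ (Z \ {0}).image (fun z => -(q : ZMod n) * z) = ∅ := by
  have hq2 : 2 ≤ q := hq.two_le
  have hδ : δ * (q + 1) ≤ n := (Nat.le_div_iff_mul_le (by omega)).1 hδ2
  have key : Z ∩ Z.image (fun z => -(q : ZMod n) * z) = {0} := by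
    have h0 : (0 : ZMod n) ∈ Z := by
      rw [hZ, Finset.mem_image]
      exact ⟨0, by simp, by simp⟩
    ext x
    rw [Finset.mem_inter, Finset.mem_singleton]
    constructor
    · rintro ⟨hx, hx2⟩
      rw [Finset.mem_image] at hx2
      obtain ⟨y, hy, hxy⟩ := hx2
      rw [hZ, Finset.mem_image] at hx hy
      obtain ⟨a, ha, rfl⟩ := hx
      obtain ⟨b, hb, rfl⟩ := hy
      rw [Finset.mem_Icc] at ha hb
      have hd : (n : ℤ) ∣ a + q * b := by
        rw [← CharP.intCast_eq_zero_iff (ZMod n) n]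
        push_cast
        rw [← hxy]
        ring
      rw [core_aux q n δ hq2 hdvd hδ a b ha.1 ha.2 hb.1 hb.2 hd hδ1]
      simp
    · rintro rfl
      exact ⟨h0, Finset.mem_image.2 ⟨0, h0, by simp⟩⟩
  refine ⟨key, ?_⟩
  rw [Finset.eq_empty_iff_forall_notMem]
  intro x hx
  rw [Finset.mem_inter, Finset.mem_sdiff] at hx
  obtain ⟨⟨hx1, hx0⟩, hx2⟩ := hx
  apply hx0
  rw [← key, Finset.mem_inter]
  exact ⟨hx1, Finset.image_subset_image Finset.sdiff_subset hx2⟩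
end

section
/- Let q be a prime power, let n be a positive integer dividing q^2+1, let F be a finite field with q^4 elements, and let α ∈ F be a primitive n-th root of unity (which exists since n divides q^4−1). Let δ be an integer with 1 ≤ δ ≤ ⌊n/(q+1)⌋ and let Z = {0} ∪ {i mod n, −i mod n : 1 ≤ i ≤ δ} ⊆ ℤ/nℤ. Let H be the matrix over F with rows indexed by Z and columns indexed by j ∈ {0,1,…,n−1}, whose (z,j) entry is α^{z·j}. Then the rank of H·H† equals 1. -/
open Matrix

lemma stmt1_arith (q n : ℕ) (hq : 2 ≤ q) (hn : 0 < n) (hdvd : n ∣ q ^ 2 + 1)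
    (δ : ℕ) (hδ2 : δ ≤ n / (q + 1)) (a b : ℤ)
    (ha : -(δ:ℤ) ≤ a ∧ a ≤ δ) (hb : -(δ:ℤ) ≤ b ∧ b ≤ δ) (h : (n : ℤ) ∣ a + q * b) :
    a = 0 ∧ b = 0 := by
  have h1 : δ * (q + 1) ≤ n := (Nat.le_div_iff_mul_le (by omega)).1 hδ2
  have h2 : n ≤ q ^ 2 + 1 := Nat.le_of_dvd (by positivity) hdvd
  have h3 : δ < q := by nlinarith
  have h4 : δ * (q + 1) ≠ n := by
    intro h4
    have h5 : (q + 1) ∣ q ^ 2 + 1 := (Dvd.intro_left δ h4).trans hdvd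
    have h6 : (q + 1) ∣ 2 := by
      have : ((q + 1 : ℕ) : ℤ) ∣ ((2 : ℕ) : ℤ) := by
        have h7 : ((q + 1 : ℕ) : ℤ) ∣ ((q ^ 2 + 1 : ℕ) : ℤ) := by exact_mod_cast h5
        have h8 : ((2 : ℕ) : ℤ) = ((q ^ 2 + 1 : ℕ) : ℤ) - ((q + 1 : ℕ) : ℤ) * (q - 1) := by
          push_cast; ring
        rw [h8]
        exact dvd_sub h7 (dvd_mul_right _ _)
      exact_mod_cast this
    have := Nat.le_of_dvd (by norm_num) h6
    omega
  have h5 : (δ : ℤ) * (q + 1) < n := by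
    have : δ * (q + 1) < n := lt_of_le_of_ne h1 h4
    exact_mod_cast this
  have hq' : (2:ℤ) ≤ q := by exact_mod_cast hq
  have h3' : (δ:ℤ) < q := by exact_mod_cast h3
  have h6 : a + q * b = 0 := by
    apply Int.eq_zero_of_abs_lt_dvd h
    rw [abs_lt]
    constructor <;> nlinarith
  have hb0 : b = 0 := by
    rcases lt_trichotomy b 0 with hb | hb | hb
    · nlinarith
    · exact hb
    · nlinarith
  subst hb0
  simpa using h6

/-- Let `q` be a prime power, `n ∣ q² + 1` positive, `F` a finite field with
`q⁴` elements, `α ∈ F` a primitive `n`-th root of unity, `1 ≤ δ ≤ ⌊n/(q+1)⌋`, and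
`Z = {0} ∪ {±i mod n : 1 ≤ i ≤ δ} ⊆ ℤ/nℤ`.  Let `H` be the matrix with rows indexed by `Z`
and columns by `{0, …, n-1}` whose `(z, j)` entry is `α^(z·j)`.  Then `rank (H·H†) = 1`,
where `H†` is the transpose of the entrywise `q`-th power of `H`. -/
theorem stmt1 (q n : ℕ) (hq : IsPrimePow q) (hn : 0 < n) (hdvd : n ∣ q ^ 2 + 1)
    (F : Type*) [Field F] [Fintype F] (hF : Fintype.card F = q ^ 4)
    (α : F) (hα : IsPrimitiveRoot α n)
    (δ : ℕ) (hδ1 : 1 ≤ δ) (hδ2 : δ ≤ n / (q + 1))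
    (Z : Finset (ZMod n))
    (hZ : Z = (Finset.Icc (-(δ : ℤ)) (δ : ℤ)).image (fun (i : ℤ) => (i : ZMod n)))
    (H : Matrix ↥Z (Fin n) F)
    (hH : ∀ (z : ↥Z) (j : Fin n), H z j = α ^ ((z.1 * ((j : ℕ) : ZMod n)).val)) :
    (H * (H.map (fun x => x ^ q))ᵀ).rank = 1 := by
  haveI : NeZero n := ⟨hn.ne'⟩
  have hnF : (n : F) ≠ 0 := by
    intro h0
    have h1 : (q : F) ^ 4 = 0 := by
      have := Nat.cast_card_eq_zero F
      rw [hF] at this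
      exact_mod_cast this
    have h2 : (q : F) = 0 := by simpa using h1
    obtain ⟨k, hk⟩ := hdvd
    have h3 : ((q ^ 2 + 1 : ℕ) : F) = ((n * k : ℕ) : F) := by rw [hk]
    push_cast at h3
    simp [h2, h0] at h3
  have hpow : ∀ a b : ℕ, (a : ZMod n) = b → α ^ a = α ^ b := by
    intro a b hab
    rw [ZMod.natCast_eq_natCast_iff] at hab
    rw [← pow_mod_orderOf α a, ← pow_mod_orderOf α b, ← hα.eq_orderOf]
    exact congrArg _ hab
  have hentry : ∀ z w : ↥Z, (H * (H.map (fun x => x ^ q))ᵀ) z w =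
      if z.1 + q * w.1 = 0 then (n : F) else 0 := by
    intro z w
    have hs : (H * (H.map (fun x => x ^ q))ᵀ) z w
        = ∑ j ∈ Finset.range n, (α ^ ((z.1 + q * w.1).val)) ^ j := by
      rw [Matrix.mul_apply, ← Fin.sum_univ_eq_sum_range]
      refine Finset.sum_congr rfl fun j _ => ?_
      rw [Matrix.transpose_apply, Matrix.map_apply, hH, hH, ← pow_mul, ← pow_add, ← pow_mul]
      apply hpow
      push_cast
      simp only [ZMod.natCast_zmod_val]
      ring
    rw [hs]
    split_ifs with h
    · simp [h]
    · set β := α ^ ((z.1 + q * w.1).val) with hβ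
      have hβ1 : β ≠ 1 := by
        intro hb
        have := (hα.pow_eq_one_iff_dvd _).1 hb
        exact h (by rwa [← ZMod.natCast_eq_zero_iff, ZMod.natCast_zmod_val] at this)
      have hβn : β ^ n = 1 := by
        rw [hβ, ← pow_mul, mul_comm, pow_mul, hα.pow_eq_one, one_pow]
      have := mul_geom_sum β n
      rw [hβn, sub_self] at this
      exact (mul_eq_zero.1 this).resolve_left (sub_ne_zero.2 hβ1)
  have h0Z : (0 : ZMod n) ∈ Z := by
    rw [hZ, Finset.mem_image]
    exact ⟨0, by simp, by simp⟩
  have hzero : ∀ z w : ↥Z, z.1 + q * w.1 = 0 → z = ⟨0, h0Z⟩ ∧ w = ⟨0, h0Z⟩ := by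
    rintro ⟨z, hz⟩ ⟨w, hw⟩ h
    have hz' := hz
    have hw' := hw
    rw [hZ, Finset.mem_image] at hz' hw'
    obtain ⟨a, ha, rfl⟩ := hz'
    obtain ⟨b, hb, rfl⟩ := hw'
    rw [Finset.mem_Icc] at ha hb
    have hd : (n : ℤ) ∣ a + q * b := by
      rw [← ZMod.intCast_zmod_eq_zero_iff_dvd]
      push_cast
      exact h
    obtain ⟨rfl, rfl⟩ := stmt1_arith q n hq.two_le hn hdvd δ hδ2 a b ha hb hd
    simp
  have hM : H * (H.map (fun x => x ^ q))ᵀ =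
      Matrix.vecMulVec (Pi.single ⟨0, h0Z⟩ (n : F)) (Pi.single ⟨0, h0Z⟩ 1) := by
    ext z w
    rw [hentry, Matrix.vecMulVec_apply]
    split_ifs with h
    · obtain ⟨rfl, rfl⟩ := hzero z w h
      simp
    · by_cases hz : z = ⟨0, h0Z⟩
      · by_cases hw : w = ⟨0, h0Z⟩
        · subst hz hw; simp at h
        · simp [Pi.single_apply, hw]
      · simp [Pi.single_apply, hz]
  apply le_antisymm
  · rw [hM]; exact Matrix.rank_vecMulVec_le _ _
  · rw [Nat.one_le_iff_ne_zero]
    intro hr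
    have h1 : H * (H.map (fun x => x ^ q))ᵀ = 0 := by
      rw [Matrix.rank, Submodule.finrank_eq_zero, LinearMap.range_eq_bot] at hr
      ext z w
      have h2 := congrFun (LinearMap.congr_fun hr (Pi.single w 1)) z
      rw [Matrix.mulVecLin_apply, Matrix.mulVec_single_one] at h2
      exact h2
    have h2 := hentry ⟨0, h0Z⟩ ⟨0, h0Z⟩
    rw [h1] at h2
    simp at h2
    exact hnF h2.symm
end

section
/- Let q be a prime power, let n be a positive integer dividing q^2+1, let F be a finite field with q^4 elements, let K ⊆ F be its subfield with q^2 elements, and let α ∈ F be a primitive n-th root of unity. Let δ be an integer with 1 ≤ δ ≤ ⌊n/(q+1)⌋ and let Z = {0} ∪ {i mod n, −i mod n : 1 ≤ i ≤ δ} ⊆ ℤ/nℤ. Let C = {c ∈ K^n : for all z ∈ Z, Σ_{j=0}^{n−1} c_j·α^{z·j} = 0} (a K-linear subspace of K^n). Then dim_K C = n − 2δ − 1, and every nonzero codeword of C has Hamming weight at least 2δ + 2 (so C is an MDS code with parameters [n, n−2δ−1, 2δ+2] over K). -/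
set_option synthInstance.maxHeartbeats 400000

lemma aux_zpow {F : Type*} [Field F] {n : ℕ} (hn : 0 < n) (α : F) (hα : IsPrimitiveRoot α n)
    (a : ℤ) : α ^ ((a : ZMod n).val) = α ^ a := by
  haveI : NeZero n := ⟨hn.ne'⟩
  have h0 : α ≠ 0 := hα.ne_zero hn.ne'
  have h1 := ZMod.val_intCast (n := n) a
  rw [← zpow_natCast, h1]
  conv_rhs => rw [← Int.emod_add_mul_ediv a n]
  rw [zpow_add₀ h0, zpow_mul, zpow_natCast, hα.pow_eq_one, one_zpow, mul_one]

lemma aux_dist {F : Type*} [Field F] {n : ℕ} (hn : 0 < n) (α : F) (hα : IsPrimitiveRoot α n)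
    (δ : ℕ) (c : Fin n → F)
    (hc : ∀ i : ℤ, -(δ : ℤ) ≤ i → i ≤ δ → ∑ j : Fin n, c j * α ^ (i * (j : ℕ)) = 0)
    (hne : c ≠ 0) : 2 * δ + 2 ≤ {j : Fin n | c j ≠ 0}.ncard := by
  classical
  have h0 : α ≠ 0 := hα.ne_zero hn.ne'
  by_contra hlt
  push Not at hlt
  obtain ⟨j0, hj0⟩ := Function.ne_iff.mp hne
  simp only [Pi.zero_apply] at hj0
  let S : Finset (Fin n) := Finset.univ.filter (fun j => c j ≠ 0)
  have hS : {j : Fin n | c j ≠ 0} = (S : Set (Fin n)) := by ext; simp [S]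
  rw [hS, Set.ncard_coe_finset] at hlt
  have hj0S : j0 ∈ S := by simp [S, hj0]
  let P : Polynomial F := ∏ j ∈ S.erase j0, (Polynomial.X - Polynomial.C (α ^ (j : ℕ)))
  have hdeg : P.natDegree < 2 * δ + 1 := by
    simp only [P]
    rw [Polynomial.natDegree_finset_prod_X_sub_C_eq_card, Finset.card_erase_of_mem hj0S]
    have := Finset.card_pos.mpr ⟨j0, hj0S⟩
    omega
  have key : ∑ j : Fin n, c j * α ^ (-(δ : ℤ) * (j : ℕ)) * P.eval (α ^ (j : ℕ)) = 0 := by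
    simp_rw [Polynomial.eval_eq_sum_range' hdeg, Finset.mul_sum]
    rw [Finset.sum_comm]
    refine Finset.sum_eq_zero fun k hk => ?_
    have hk' := Finset.mem_range.mp hk
    have := hc (-(δ : ℤ) + k) (by omega) (by omega)
    rw [← mul_zero (P.coeff k), ← this, Finset.mul_sum]
    refine Finset.sum_congr rfl fun j _ => ?_
    rw [add_mul, zpow_add₀ h0, ← pow_mul, ← zpow_natCast α ((j : ℕ) * k)]
    push_cast
    rw [mul_comm (k : ℤ)]
    ring
  rw [Finset.sum_eq_single j0] at key
  · have h2 : P.eval (α ^ (j0 : ℕ)) ≠ 0 := by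
      simp only [P, Polynomial.eval_prod, Polynomial.eval_sub, Polynomial.eval_X,
        Polynomial.eval_C]
      refine Finset.prod_ne_zero_iff.mpr fun j hj => ?_
      intro h
      have := hα.pow_inj j0.2 j.2 (sub_eq_zero.mp h)
      exact (Finset.mem_erase.mp hj).1 (Fin.ext this.symm)
    exact mul_ne_zero (mul_ne_zero hj0 (zpow_ne_zero _ h0)) h2 key
  · intro j _ hj
    by_cases hcj : c j = 0
    · simp [hcj]
    · have : P.eval (α ^ (j : ℕ)) = 0 := by
        simp only [P, Polynomial.eval_prod]
        exact Finset.prod_eq_zero (i := j) (by simp [S, hj, hcj]) (by simp)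
      rw [this, mul_zero]
  · simp

lemma aux_singleton {K : Type*} [Field K] {n m : ℕ} (hm : m ≤ n)
    (C : Submodule K (Fin n → K))
    (h : ∀ c ∈ C, c ≠ 0 → m + 1 ≤ {j : Fin n | c j ≠ 0}.ncard) :
    Module.finrank K C ≤ n - m := by
  let f : (Fin n → K) →ₗ[K] (Fin (n - m) → K) :=
    LinearMap.funLeft K K (Fin.castLE (Nat.sub_le n m))
  have hinj : Function.Injective (f.comp C.subtype) := by
    rw [← LinearMap.ker_eq_bot, LinearMap.ker_eq_bot']
    intro c hc
    by_contra hne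
    have h1 := h c.1 c.2 (by simpa using hne)
    have hsub : {j : Fin n | c.1 j ≠ 0} ⊆ {j : Fin n | n - m ≤ j.val} := by
      intro j hj
      by_contra hlt
      simp only [Set.mem_setOf_eq, not_le] at hlt
      exact hj (congrFun hc ⟨j.1, hlt⟩)
    have h2 := Set.ncard_le_ncard hsub (Set.toFinite _)
    have h3 : {j : Fin n | n - m ≤ j.val}.ncard ≤ m := by
      have : ({j : Fin n | n - m ≤ j.val}).ncard ≤ ((Finset.Ico (n-m) n : Finset ℕ) : Set ℕ).ncard :=
        Set.ncard_le_ncard_of_injOn (fun j => j.val)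
          (by intro j hj; simpa using hj) (fun a _ b _ hab => Fin.ext hab)
          (Set.toFinite _)
      rw [Set.ncard_coe_finset, Nat.card_Ico] at this
      omega
    omega
  simpa using LinearMap.finrank_le_finrank_of_injective hinj

/-- Let `q` be a prime power, `n ∣ q² + 1` positive, `F` a finite field with
`q⁴` elements, `K ⊆ F` its subfield with `q²` elements, `α ∈ F` a primitive `n`-th root of
unity, `1 ≤ δ ≤ ⌊n/(q+1)⌋`, and `Z = {0} ∪ {±i mod n : 1 ≤ i ≤ δ} ⊆ ℤ/nℤ`.  Let
`C = {c ∈ Kⁿ : ∀ z ∈ Z, Σⱼ cⱼ·α^(z·j) = 0}`.  Then `dim_K C = n - 2δ - 1` and every nonzero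
codeword of `C` has Hamming weight at least `2δ + 2`. -/
theorem stmt2 (q n : ℕ) (hq : IsPrimePow q) (hn : 0 < n) (hdvd : n ∣ q ^ 2 + 1)
    (F : Type*) [Field F] [Fintype F] (hF : Fintype.card F = q ^ 4)
    (K : Subfield F) (hK : Nat.card K = q ^ 2)
    (α : F) (hα : IsPrimitiveRoot α n)
    (δ : ℕ) (hδ1 : 1 ≤ δ) (hδ2 : δ ≤ n / (q + 1))
    (Z : Finset (ZMod n))
    (hZ : Z = (Finset.Icc (-(δ : ℤ)) (δ : ℤ)).image (fun (i : ℤ) => (i : ZMod n)))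
    (C : Submodule K (Fin n → K))
    (hC : ∀ c, c ∈ C ↔ ∀ z ∈ Z,
      ∑ j : Fin n, (c j : F) * α ^ ((z * ((j : ℕ) : ZMod n)).val) = 0) :
    Module.finrank K C = n - (2 * δ + 1) ∧
    ∀ c ∈ C, c ≠ 0 → 2 * δ + 2 ≤ {j : Fin n | c j ≠ 0}.ncard := by
  classical
  have hq2 : 2 ≤ q := hq.two_le
  have h0 : α ≠ 0 := hα.ne_zero hn.ne'
  have hle : 2 * δ + 1 ≤ n := by
    have h1 := (Nat.le_div_iff_mul_le (by omega)).mp hδ2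
    nlinarith
  have hC' : ∀ c, c ∈ C ↔ ∀ i : ℤ, -(δ : ℤ) ≤ i → i ≤ δ →
      ∑ j : Fin n, (c j : F) * α ^ (i * (j : ℕ)) = 0 := by
    intro c
    have hz : ∀ (i : ℤ) (j : Fin n),
        α ^ (((i : ZMod n) * ((j : ℕ) : ZMod n)).val) = α ^ (i * (j : ℕ)) := by
      intro i j
      rw [← aux_zpow hn α hα]
      push_cast
      rfl
    rw [hC, hZ]
    constructor
    · intro h i h1 h2
      have := h (i : ZMod n) (Finset.mem_image_of_mem _ (Finset.mem_Icc.mpr ⟨h1, h2⟩))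
      simpa only [hz] using this
    · intro h z hz'
      obtain ⟨i, hi, rfl⟩ := Finset.mem_image.mp hz'
      obtain ⟨h1, h2⟩ := Finset.mem_Icc.mp hi
      simpa only [hz] using h i h1 h2
  have hdist : ∀ c ∈ C, c ≠ 0 → 2 * δ + 2 ≤ {j : Fin n | c j ≠ 0}.ncard := by
    intro c hc hne
    have := aux_dist hn α hα δ (fun j => (c j : F)) ((hC' c).mp hc) (by
      intro h
      apply hne
      funext j
      exact Subtype.ext (congrFun h j))
    simpa using this
  refine ⟨le_antisymm (aux_singleton hle C hdist) ?_, hdist⟩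
  haveI : Fintype K := Fintype.ofFinite K
  have hcK : Fintype.card K = q ^ 2 := by rw [← Nat.card_eq_fintype_card]; exact hK
  have hr : Module.finrank K F = 2 := by
    have h := Module.card_eq_pow_finrank (K := K) (V := F)
    rw [hF, hcK, ← pow_mul] at h
    have := Nat.pow_right_injective hq2 h
    omega
  let g : (Fin n → K) →ₗ[K] K × (Fin δ → F) :=
    LinearMap.prod (∑ j : Fin n, LinearMap.proj j)
      (LinearMap.pi fun i : Fin δ => ∑ j : Fin n,
        (LinearMap.toSpanSingleton K F (α ^ (((i : ℕ) + 1 : ℤ) * (j : ℕ)))).comp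
          (LinearMap.proj j))
  have hker : LinearMap.ker g ≤ C := by
    intro c hc
    rw [LinearMap.mem_ker] at hc
    have e1 : ∑ j : Fin n, c j = 0 := by
      have := congrArg Prod.fst hc
      simpa [g] using this
    have e2 : ∀ i : ℤ, 1 ≤ i → i ≤ δ → ∑ j : Fin n, (c j : F) * α ^ (i * (j : ℕ)) = 0 := by
      intro i hi1 hi2
      have h1 := congrFun (congrArg Prod.snd hc) ⟨(i - 1).toNat, by omega⟩
      have h2 : ((i.toNat - 1 : ℕ) : ℤ) + 1 = i := by omega
      simpa [g, h2, Subfield.smul_def] using h1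
    rw [hC']
    intro i hi1 hi2
    rcases lt_trichotomy i 0 with hi | hi | hi
    · have h1 := e2 (-i) (by omega) (by omega)
      have h2 := congrArg (FiniteField.frobeniusAlgHom K F) h1
      rw [map_sum, map_zero] at h2
      rw [← h2]
      refine Finset.sum_congr rfl fun j _ => ?_
      rw [map_mul]
      have h3 : FiniteField.frobeniusAlgHom K F (c j : F) = c j :=
        (FiniteField.frobeniusAlgHom K F).commutes (c j)
      rw [h3, map_zpow₀]
      have h4 : FiniteField.frobeniusAlgHom K F α = α⁻¹ := by
        rw [FiniteField.coe_frobeniusAlgHom, hcK]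
        apply eq_inv_of_mul_eq_one_left
        rw [← pow_succ]
        exact (hα.pow_eq_one_iff_dvd _).mpr hdvd
      rw [h4, inv_zpow', neg_mul, neg_neg]
    · subst hi
      simp only [zero_mul, zpow_zero, mul_one]
      have := congrArg (fun x : K => (x : F)) e1
      simpa using this
    · exact e2 i (by omega) hi2
  have h1 := LinearMap.finrank_range_add_finrank_ker g
  have h2 := Submodule.finrank_le (LinearMap.range g)
  have h3 := Submodule.finrank_mono hker
  have h4 : Module.finrank K (K × (Fin δ → F)) = 1 + δ * 2 := by
    rw [Module.finrank_prod, Module.finrank_self, Module.finrank_pi_fintype]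
    simp [hr]
  rw [Module.finrank_fin_fun] at h1
  omega
end

section
/- Let q be a prime power and let n be a positive integer dividing q^2−1. Let δ be an integer with 1 ≤ δ ≤ ⌊n/(q+1)⌋ − 1, and in ℤ/nℤ set Z₁ = {−δ, −δ+1, …, −1} (mod n), Z₂ = {1, 2, …, δ} (mod n), and Z = Z₁ ∪ {0} ∪ Z₂. Then Z₁ ∩ {−q·z : z ∈ Z₁} = ∅, Z₂ ∩ {−q·z : z ∈ Z₂} = ∅, Z₁ ∩ {−q·z : z ∈ Z₂} = ∅, and consequently Z ∩ {−q·z : z ∈ Z} = {0}. -/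
theorem key_aux (q n : ℕ) (hq : 2 ≤ q) (hdvd : n ∣ q ^ 2 - 1)
    (δ : ℕ) (hδ1 : 1 ≤ δ) (hδ2 : δ ≤ n / (q + 1) - 1) (x y : ℤ)
    (hx : |x| ≤ δ) (hy : |y| ≤ δ) (h : (x : ZMod n) = -(q : ZMod n) * (y : ZMod n)) :
    x = 0 ∧ y = 0 := by
  have h1 : (δ + 1) * (q + 1) ≤ n :=
    le_trans (Nat.mul_le_mul_right _ (by omega)) (Nat.div_mul_le_self n (q + 1))
  have h2 : n ≤ q ^ 2 - 1 := Nat.le_of_dvd (by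
    have : 2 ^ 2 ≤ q ^ 2 := Nat.pow_le_pow_left hq 2
    omega) hdvd
  have h3 : δ + 1 < q := by
    by_contra hc
    have : q * (q + 1) ≤ (δ + 1) * (q + 1) := Nat.mul_le_mul_right _ (by omega)
    have e : q * (q + 1) = q ^ 2 + q := by ring
    omega
  have h4 : (n : ℤ) ∣ x + q * y := by
    haveI : NeZero n := ⟨by rintro rfl; simp at h1⟩
    apply (ZMod.intCast_zmod_eq_zero_iff_dvd _ n).1
    push_cast
    rw [h]; ring
  have h1' : ((δ : ℤ) + 1) * (q + 1) ≤ n := by exact_mod_cast h1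
  have h5 : |x + q * y| < n := by
    calc |x + q * y| ≤ |x| + |(q : ℤ) * y| := abs_add_le _ _
      _ = |x| + q * |y| := by rw [abs_mul, Nat.abs_cast]
      _ ≤ δ + q * δ := by gcongr
      _ < n := by nlinarith
  have h6 := Int.eq_zero_of_abs_lt_dvd h4 h5
  have hy0 : y = 0 := by
    by_contra hne
    have a1 : 1 ≤ |y| := Int.one_le_abs hne
    have a2 : |x| = q * |y| := by
      rw [show x = -(q * y) by linarith, abs_neg, abs_mul, Nat.abs_cast]
    have : (δ : ℤ) + 1 < q := by exact_mod_cast h3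
    nlinarith
  subst hy0
  exact ⟨by simpa using h6, rfl⟩

/-- Let `q` be a prime power, `n ∣ q² - 1` positive, and
`1 ≤ δ ≤ ⌊n/(q+1)⌋ - 1`.  In `ℤ/nℤ` set `Z₁ = {-δ, …, -1}`, `Z₂ = {1, …, δ}` and
`Z = Z₁ ∪ {0} ∪ Z₂`.  Then `Z₁ ∩ (-q)·Z₁ = ∅`, `Z₂ ∩ (-q)·Z₂ = ∅`, `Z₁ ∩ (-q)·Z₂ = ∅`,
and consequently `Z ∩ (-q)·Z = {0}`. -/
theorem stmt3 (q n : ℕ) (hq : IsPrimePow q) (hn : 0 < n) (hdvd : n ∣ q ^ 2 - 1)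
    (δ : ℕ) (hδ1 : 1 ≤ δ) (hδ2 : δ ≤ n / (q + 1) - 1)
    (Z₁ Z₂ Z : Finset (ZMod n))
    (hZ₁ : Z₁ = (Finset.Icc (-(δ : ℤ)) (-1 : ℤ)).image (fun (i : ℤ) => (i : ZMod n)))
    (hZ₂ : Z₂ = (Finset.Icc (1 : ℤ) (δ : ℤ)).image (fun (i : ℤ) => (i : ZMod n)))
    (hZ : Z = Z₁ ∪ {0} ∪ Z₂) :
    Z₁ ∩ Z₁.image (fun z => -(q : ZMod n) * z) = ∅ ∧
    Z₂ ∩ Z₂.image (fun z => -(q : ZMod n) * z) = ∅ ∧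
    Z₁ ∩ Z₂.image (fun z => -(q : ZMod n) * z) = ∅ ∧
    Z ∩ Z.image (fun z => -(q : ZMod n) * z) = {0} := by
  have hq2 : 2 ≤ q := hq.two_le
  have key := key_aux q n hq2 hdvd δ hδ1 hδ2
  have m1 : ∀ z ∈ Z₁, ∃ x : ℤ, |x| ≤ δ ∧ x ≠ 0 ∧ (x : ZMod n) = z := by
    intro z hz
    rw [hZ₁, Finset.mem_image] at hz
    obtain ⟨x, hx, rfl⟩ := hz
    rw [Finset.mem_Icc] at hx
    exact ⟨x, abs_le.2 ⟨by omega, by omega⟩, by omega, rfl⟩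
  have m2 : ∀ z ∈ Z₂, ∃ x : ℤ, |x| ≤ δ ∧ x ≠ 0 ∧ (x : ZMod n) = z := by
    intro z hz
    rw [hZ₂, Finset.mem_image] at hz
    obtain ⟨x, hx, rfl⟩ := hz
    rw [Finset.mem_Icc] at hx
    exact ⟨x, abs_le.2 ⟨by omega, by omega⟩, by omega, rfl⟩
  have m : ∀ z ∈ Z, ∃ x : ℤ, |x| ≤ δ ∧ (x : ZMod n) = z := by
    intro z hz
    rw [hZ, Finset.mem_union, Finset.mem_union, Finset.mem_singleton] at hz
    rcases hz with (hz | hz) | hz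
    · obtain ⟨x, a, _, b⟩ := m1 z hz
      exact ⟨x, a, b⟩
    · exact ⟨0, by simp, by simp [hz]⟩
    · obtain ⟨x, a, _, b⟩ := m2 z hz
      exact ⟨x, a, b⟩
  have gen : ∀ A B : Finset (ZMod n),
      (∀ z ∈ A, ∃ x : ℤ, |x| ≤ δ ∧ x ≠ 0 ∧ (x : ZMod n) = z) →
      (∀ z ∈ B, ∃ x : ℤ, |x| ≤ δ ∧ x ≠ 0 ∧ (x : ZMod n) = z) →
      A ∩ B.image (fun z => -(q : ZMod n) * z) = ∅ := by
    intro A B hA hB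
    rw [Finset.eq_empty_iff_forall_notMem]
    intro z hz
    rw [Finset.mem_inter, Finset.mem_image] at hz
    obtain ⟨hz, w, hw, hwz⟩ := hz
    obtain ⟨x, hx, hx0, rfl⟩ := hA z hz
    obtain ⟨y, hy, _, rfl⟩ := hB w hw
    exact hx0 (key x y hx hy hwz.symm).1
  refine ⟨gen _ _ m1 m1, gen _ _ m2 m2, gen _ _ m1 m2, ?_⟩
  have h0 : (0 : ZMod n) ∈ Z := by simp [hZ]
  ext z
  rw [Finset.mem_inter, Finset.mem_image, Finset.mem_singleton]
  constructor
  · rintro ⟨hz, w, hw, hwz⟩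
    obtain ⟨x, hx, rfl⟩ := m z hz
    obtain ⟨y, hy, rfl⟩ := m w hw
    rw [(key x y hx hy hwz.symm).1, Int.cast_zero]
  · rintro rfl
    exact ⟨h0, 0, h0, by simp⟩
end

section
/- Let q be a prime power, let n be a positive integer dividing q^2−1, let F be a finite field with q^2 elements, and let α ∈ F be a primitive n-th root of unity. Let δ be an integer with 1 ≤ δ ≤ ⌊n/(q+1)⌋ − 1 and let Z = {−δ, −δ+1, …, −1, 0, 1, …, δ} regarded as a subset of ℤ/nℤ. Let H be the matrix over F with rows indexed by Z and columns indexed by j ∈ {0,1,…,n−1}, whose (z,j) entry is α^{z·j}. Then the rank of H·H† equals 1. -/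
open Matrix

/-- Let `q` be a prime power, `n ∣ q² - 1` positive, `F` a finite field with
`q²` elements, `α ∈ F` a primitive `n`-th root of unity, `1 ≤ δ ≤ ⌊n/(q+1)⌋ - 1`, and
`Z = {-δ, …, -1, 0, 1, …, δ} ⊆ ℤ/nℤ`.  Let `H` be the matrix with rows indexed by `Z` and
columns by `{0, …, n-1}` whose `(z, j)` entry is `α^(z·j)`.  Then `rank (H·H†) = 1`. -/
theorem stmt4 (q n : ℕ) (hq : IsPrimePow q) (hn : 0 < n) (hdvd : n ∣ q ^ 2 - 1)
    (F : Type*) [Field F] [Fintype F] (hF : Fintype.card F = q ^ 2)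
    (α : F) (hα : IsPrimitiveRoot α n)
    (δ : ℕ) (hδ1 : 1 ≤ δ) (hδ2 : δ ≤ n / (q + 1) - 1)
    (Z : Finset (ZMod n))
    (hZ : Z = (Finset.Icc (-(δ : ℤ)) (δ : ℤ)).image (fun (i : ℤ) => (i : ZMod n)))
    (H : Matrix ↥Z (Fin n) F)
    (hH : ∀ (z : ↥Z) (j : Fin n), H z j = α ^ ((z.1 * ((j : ℕ) : ZMod n)).val)) :
    (H * (H.map (fun x => x ^ q))ᵀ).rank = 1 := by
  haveI : NeZero n := ⟨hn.ne'⟩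
  have hq1 : 1 < q := hq.one_lt
  have hn1 : α ^ n = 1 := hα.pow_eq_one
  have hnle : n ≤ (q - 1) * (q + 1) := by
    have h0 : q ^ 2 - 1 = (q - 1) * (q + 1) := by
      obtain ⟨r, rfl⟩ : ∃ r, q = r + 1 := ⟨q - 1, by omega⟩
      simp only [Nat.add_sub_cancel]
      have : (r + 1) ^ 2 = r * (r + 1 + 1) + 1 := by ring
      omega
    rw [← h0]
    refine Nat.le_of_dvd ?_ hdvd
    have : 1 < q ^ 2 := Nat.one_lt_pow (by norm_num) hq1
    omega
  have hd : δ + 1 ≤ n / (q + 1) := by omega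
  have hd1 : (δ + 1) * (q + 1) ≤ n := (Nat.le_div_iff_mul_le (by omega)).1 hd
  have hdq : δ + 1 ≤ q - 1 := by
    have : (δ + 1) * (q + 1) ≤ (q - 1) * (q + 1) := hd1.trans hnle
    exact Nat.le_of_mul_le_mul_right this (by omega)
  have hnF : (n : F) ≠ 0 := by
    intro h
    have h1 : ((q ^ 2 : ℕ) : F) = 0 := by rw [← hF]; exact FiniteField.cast_card_eq_zero F
    obtain ⟨k, hk⟩ := hdvd
    have h2 : q ^ 2 = n * k + 1 := by
      have : 0 < q ^ 2 := by positivity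
      omega
    rw [h2] at h1
    push_cast at h1
    rw [h] at h1
    simp at h1
  have key : ∀ z ∈ Z, ∀ w ∈ Z, z + (q : ZMod n) * w = 0 → z = 0 ∧ w = 0 := by
    intro z hz w hw h
    rw [hZ, Finset.mem_image] at hz hw
    obtain ⟨a, ha, rfl⟩ := hz
    obtain ⟨b, hb, rfl⟩ := hw
    rw [Finset.mem_Icc] at ha hb
    have h1 : ((a + q * b : ℤ) : ZMod n) = 0 := by push_cast; exact h
    rw [ZMod.intCast_zmod_eq_zero_iff_dvd] at h1
    have hd1' : ((δ : ℤ) + 1) * (q + 1) ≤ n := by exact_mod_cast hd1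
    have hdq' : (δ : ℤ) + 1 < q := by omega
    have h2 : a + q * b = 0 := by
      apply Int.eq_zero_of_abs_lt_dvd h1
      rw [abs_lt]
      constructor <;> nlinarith
    have hb0 : b = 0 := by
      by_contra hne
      rcases lt_or_gt_of_ne hne with h3 | h3 <;> nlinarith
    subst hb0
    have : a = 0 := by simpa using h2
    subst this
    simp
  have hent : ∀ (z w : ↥Z), (H * (H.map (fun x => x ^ q))ᵀ) z w
      = if z.1 + (q : ZMod n) * w.1 = 0 then (n : F) else 0 := by
    intro z w
    have hval : ∀ (x : ZMod n) (j : ℕ), α ^ ((x * (j : ZMod n)).val) = (α ^ x.val) ^ j := by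
      intro x j
      rw [← pow_mul]
      rw [pow_eq_pow_mod (x.val * j) hn1, ZMod.val_mul, ZMod.val_natCast, Nat.mul_mod_mod]
    have hs : (H * (H.map (fun x => x ^ q))ᵀ) z w
        = ∑ j ∈ Finset.range n, (α ^ (z.1.val + q * w.1.val)) ^ j := by
      rw [Matrix.mul_apply, ← Fin.sum_univ_eq_sum_range]
      refine Finset.sum_congr rfl fun j _ => ?_
      simp only [Matrix.transpose_apply, Matrix.map_apply, hH, hval]
      rw [← pow_mul, ← pow_mul, ← pow_mul, ← pow_mul, ← pow_add]
      congr 1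
      ring
    rw [hs]
    have hiff : z.1 + (q : ZMod n) * w.1 = 0 ↔ α ^ (z.1.val + q * w.1.val) = 1 := by
      rw [hα.pow_eq_one_iff_dvd, ← ZMod.natCast_eq_zero_iff]
      push_cast
      rw [ZMod.natCast_zmod_val, ZMod.natCast_zmod_val]
    split_ifs with hc
    · rw [hiff.1 hc]; simp
    · have hne : α ^ (z.1.val + q * w.1.val) ≠ 1 := fun h => hc (hiff.2 h)
      rw [geom_sum_eq hne, ← pow_mul, mul_comm, pow_mul, hn1]
      simp
  have hM : H * (H.map (fun x => x ^ q))ᵀ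
      = Matrix.diagonal (fun z : ↥Z => if z.1 = 0 then (n : F) else 0) := by
    ext z w
    rw [hent, Matrix.diagonal_apply]
    by_cases hc : z.1 + (q : ZMod n) * w.1 = 0
    · obtain ⟨h1, h2⟩ := key _ z.2 _ w.2 hc
      have : z = w := Subtype.ext (h1.trans h2.symm)
      rw [if_pos hc, if_pos this, if_pos h1]
    · rw [if_neg hc]
      split_ifs with h1 h2
      · subst h1
        exact absurd (by rw [h2]; simp) hc
      · rfl
      · rfl
  have h0Z : (0 : ZMod n) ∈ Z := by
    rw [hZ, Finset.mem_image]
    exact ⟨0, by simp, by simp⟩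
  classical
  rw [hM, Matrix.rank_diagonal, Fintype.card_eq_one_iff]
  refine ⟨⟨⟨0, h0Z⟩, by simpa using hnF⟩, ?_⟩
  rintro ⟨z, hz⟩
  apply Subtype.ext
  apply Subtype.ext
  by_contra hne
  exact hz (if_neg hne)
end

section
/- Let q be a prime power, let F be a finite field with q^2 elements, and let r be an integer with q ≤ r ≤ 2q−2. Let H be the matrix over F with rows indexed by i ∈ {0,1,…,r−1} and columns indexed by the elements x of F, whose (i,x) entry is x^i. Then the rank of H·H† equals 1. -/
open Matrix

lemma sum_pow_aux (F : Type*) [Field F] [Fintype F] (k : ℕ) (hk : k ≠ 0) :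
    ∑ x : F, x ^ k = if Fintype.card F - 1 ∣ k then -1 else 0 := by
  classical
  rw [← FiniteField.sum_pow_units F k, ← Finset.sum_erase (Finset.univ) (a := (0:F)) (by simp [hk])]
  symm
  refine Finset.sum_bij (fun (u : Fˣ) _ => (u : F)) ?_ ?_ ?_ ?_
  · intro u _; simp
  · intro u _ v _ h; exact Units.ext h
  · intro b hb
    exact ⟨Units.mk0 b (by simpa using hb), by simp, rfl⟩
  · intro u _; rfl

lemma arith_aux (q i j : ℕ) (hq : 2 ≤ q) (hi : i + 3 ≤ 2 * q) (hj : j + 3 ≤ 2 * q)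
    (h0 : i + j * q ≠ 0) (h : q ^ 2 - 1 ∣ i + j * q) : i = q - 1 ∧ j = q - 1 := by
  obtain ⟨c, hc⟩ := h
  obtain ⟨t, rfl⟩ : ∃ t, q = t + 2 := ⟨q - 2, by omega⟩
  have e : (t + 2) ^ 2 - 1 = t * t + 4 * t + 3 := by
    have : (t + 2) ^ 2 = t * t + 4 * t + 4 := by ring
    omega
  rw [e] at hc
  have c1 : c = 1 := by
    rcases Nat.lt_or_ge c 2 with h | h
    · interval_cases c
      · exact absurd (by simpa using hc) h0
      · rfl
    · exfalso; nlinarith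
  subst c1
  have h1 : j < t + 2 := by nlinarith
  have h2 : t < j := by nlinarith
  have : j = t + 1 := by omega
  subst this
  refine ⟨?_, by omega⟩
  have : i = t + 1 := by nlinarith
  omega

/-- Let `q` be a prime power, `F` a finite field with `q²` elements, and
`q ≤ r ≤ 2q - 2`.  Let `H` be the matrix with rows indexed by `i ∈ {0, …, r-1}` and
columns indexed by the elements `x` of `F`, whose `(i, x)` entry is `x^i`.
Then `rank (H·H†) = 1`. -/
theorem stmt8 (q : ℕ) (hq : IsPrimePow q)
    (F : Type*) [Field F] [Fintype F] (hF : Fintype.card F = q ^ 2)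
    (r : ℕ) (hr1 : q ≤ r) (hr2 : r ≤ 2 * q - 2)
    (H : Matrix (Fin r) F F)
    (hH : ∀ (i : Fin r) (x : F), H i x = x ^ (i : ℕ)) :
    (H * (H.map (fun x => x ^ q))ᵀ).rank = 1 := by
  have hq2 : 2 ≤ q := hq.two_le
  let a : Fin r := ⟨q - 1, by omega⟩
  have key : H * (H.map (fun x => x ^ q))ᵀ = vecMulVec (Pi.single a (-1)) (Pi.single a 1) := by
    ext i j
    have hi := i.2
    have hj := j.2
    have e : (H * (H.map (fun x => x ^ q))ᵀ) i j = ∑ x : F, x ^ ((i : ℕ) + j * q) := by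
      simp [Matrix.mul_apply, hH, pow_add, pow_mul]
    rw [e, vecMulVec_apply]
    by_cases h0 : (i : ℕ) + j * q = 0
    · have hia : i ≠ a := by
        intro h
        have : (i : ℕ) = q - 1 := by rw [h]
        omega
      rw [h0]
      simp [hia]
    rw [sum_pow_aux F _ h0, hF]
    split_ifs with hd
    · obtain ⟨h1, h2⟩ := arith_aux q i j hq2 (by omega) (by omega) h0 hd
      have h1 : i = a := Fin.ext h1
      have h2 : j = a := Fin.ext h2
      simp [h1, h2]
    · by_cases hia : i = a
      · by_cases hja : j = a
        · exfalso; apply hd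
          rw [hia, hja]
          refine ⟨1, ?_⟩
          obtain ⟨t, rfl⟩ : ∃ t, q = t + 1 := ⟨q - 1, by omega⟩
          have : (t + 1) ^ 2 = (t + t * (t + 1)) + 1 := by ring
          simp only [a, this]
          simp
        · simp [hja]
      · simp [hia]
  rw [key]
  apply le_antisymm (rank_vecMulVec_le _ _)
  rw [Nat.one_le_iff_ne_zero]
  intro h
  rw [Matrix.rank, Submodule.finrank_eq_zero, LinearMap.range_eq_bot] at h
  have := congrFun (LinearMap.congr_fun h (Pi.single a 1)) a
  simp [Matrix.mulVec_single, vecMulVec_apply] at this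
end

section
/- Let q be an odd prime power. There do not exist integers k and l with 1 ≤ k ≤ (q−1)/2 − 1 and 1 ≤ l ≤ q−1 such that −2k−1 ≡ −q(2l−1) (mod q^2−1). -/
/-- Let `q` be an odd prime power.  There do not exist integers `k, l` with
`1 ≤ k ≤ (q-1)/2 - 1` and `1 ≤ l ≤ q - 1` such that `-2k - 1 ≡ -q(2l - 1) (mod q² - 1)`. -/
theorem stmt10 (q : ℕ) (hq : IsPrimePow q) (hodd : Odd q) :
    ¬ ∃ k l : ℤ, 1 ≤ k ∧ k ≤ ((q : ℤ) - 1) / 2 - 1 ∧ 1 ≤ l ∧ l ≤ (q : ℤ) - 1 ∧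
      -2 * k - 1 ≡ -(q : ℤ) * (2 * l - 1) [ZMOD ((q : ℤ) ^ 2 - 1)] := by
  rintro ⟨k, l, hk1, hk2, hl1, hl2, h⟩
  have hk3 : 2 * k + 1 ≤ (q : ℤ) - 2 := by
    obtain ⟨m, rfl⟩ := hodd
    push_cast at *
    omega
  generalize (q : ℤ) = Q at *
  obtain ⟨c, hc⟩ := h.dvd
  have hdvd : Q ^ 2 - 1 ∣ Q * (2 * k + 1) - (2 * l - 1) :=
    ⟨Q * c + (2 * l - 1), by linear_combination Q * hc⟩
  have hpos : 0 < Q * (2 * k + 1) - (2 * l - 1) := by nlinarith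
  have hle := Int.le_of_dvd hpos hdvd
  nlinarith
end

section
/- Let q be an odd prime power and set N = q^2−1. Let δ₁ and δ₂ be integers with 1 ≤ δ₁ ≤ (q−1)/2 − 1 and (q+1)/2 ≤ δ₂ ≤ q−1, and let Z = {(2j−1) mod N : −δ₁ ≤ j ≤ δ₂} ⊆ ℤ/Nℤ. Then Z ∩ {−q·z : z ∈ Z} = {−1 mod N, q mod N}; in particular this intersection has exactly 2 elements. -/
theorem aux_arith (Q t i j k : ℤ) (hq5 : 5 ≤ Q) (hqt : Q = 2 * t + 1)
    (i1 : -(Q - 2) ≤ 2 * i - 1) (i2 : 2 * i - 1 ≤ 2 * Q - 3)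
    (j1 : -(Q - 2) ≤ 2 * j - 1) (j2 : 2 * j - 1 ≤ 2 * Q - 3)
    (hk : 2 * i - 1 + Q * (2 * j - 1) = (Q ^ 2 - 1) * k) :
    2 * i - 1 = -1 ∨ 2 * i - 1 = Q := by
  have hP : 0 ≤ Q ^ 2 - 1 := by nlinarith
  have hQ : 0 ≤ Q := by omega
  have u := mul_le_mul_of_nonneg_left j2 hQ
  have l := mul_le_mul_of_nonneg_left j1 hQ
  have k1 : k < 2 := by
    by_contra hc
    push Not at hc
    have := mul_le_mul_of_nonneg_left hc hP
    nlinarith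
  have k0 : -1 < k := by
    by_contra hc
    push Not at hc
    have := mul_le_mul_of_nonneg_left hc hP
    nlinarith
  have hk' : k = 0 ∨ k = 1 := by omega
  rcases hk' with rfl | rfl
  · right
    have a1 : j < 1 := by
      by_contra hc
      push Not at hc
      nlinarith
    have a2 : -1 < j := by
      by_contra hc
      push Not at hc
      nlinarith
    have hj0 : j = 0 := by omega
    subst hj0
    linarith
  · left
    have hi : i = Q * (t + 1 - j) := by
      have : 2 * i = Q * (Q + 1 - 2 * j) := by linarith
      have h2 : Q + 1 - 2 * j = 2 * (t + 1 - j) := by omega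
      rw [h2] at this
      linarith
    generalize t + 1 - j = d at hi
    have a1 : d < 1 := by
      by_contra hc
      push Not at hc
      nlinarith
    have a2 : -1 < d := by
      by_contra hc
      push Not at hc
      nlinarith
    have hd : d = 0 := by omega
    subst hd
    omega

theorem ZMod.intCast_eq_zero_iff_aux (a : ℤ) (b : ℕ) : (a : ZMod b) = 0 ↔ (b : ℤ) ∣ a :=
  by
  exact CharP.intCast_eq_zero_iff (ZMod b) b a

/-- Let `q` be an odd prime power, `N = q² - 1`,
`1 ≤ δ₁ ≤ (q-1)/2 - 1`, `(q+1)/2 ≤ δ₂ ≤ q - 1`, and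
`Z = {(2j-1) mod N : -δ₁ ≤ j ≤ δ₂} ⊆ ℤ/Nℤ`.  Then
`Z ∩ (-q)·Z = {-1 mod N, q mod N}`; in particular this intersection has exactly
2 elements. -/
theorem stmt11 (q : ℕ) (hq : IsPrimePow q) (hodd : Odd q)
    (δ₁ δ₂ : ℕ) (h11 : 1 ≤ δ₁) (h12 : (δ₁ : ℤ) ≤ ((q : ℤ) - 1) / 2 - 1)
    (h21 : ((q : ℤ) + 1) / 2 ≤ (δ₂ : ℤ)) (h22 : δ₂ ≤ q - 1)
    (Z : Finset (ZMod (q ^ 2 - 1)))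
    (hZ : Z = (Finset.Icc (-(δ₁ : ℤ)) (δ₂ : ℤ)).image
      (fun (j : ℤ) => ((2 * j - 1 : ℤ) : ZMod (q ^ 2 - 1)))) :
    Z ∩ Z.image (fun z => -(q : ZMod (q ^ 2 - 1)) * z) =
      {(-1 : ZMod (q ^ 2 - 1)), (q : ZMod (q ^ 2 - 1))} ∧
    (Z ∩ Z.image (fun z => -(q : ZMod (q ^ 2 - 1)) * z)).card = 2 := by
  obtain ⟨t, ht⟩ := hodd
  have hq5 : (5 : ℤ) ≤ q := by omega
  have h1q : 1 ≤ q ^ 2 := Nat.one_le_pow _ _ (by omega)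
  have hcast : ((q ^ 2 - 1 : ℕ) : ℤ) = (q : ℤ) ^ 2 - 1 := by
    push_cast [Nat.cast_sub h1q]; ring
  have hqq : (q : ZMod (q ^ 2 - 1)) * q = 1 := by
    have h : ((((q : ℤ) * q - 1 : ℤ)) : ZMod (q ^ 2 - 1)) = 0 := by
      rw [ZMod.intCast_eq_zero_iff_aux, hcast]
      exact ⟨1, by ring⟩
    push_cast at h
    exact sub_eq_zero.mp h
  have hm1 : (-1 : ZMod (q ^ 2 - 1)) ∈ Z := by
    rw [hZ, Finset.mem_image]
    exact ⟨0, by rw [Finset.mem_Icc]; omega, by push_cast; ring⟩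
  have hqZ : (q : ZMod (q ^ 2 - 1)) ∈ Z := by
    rw [hZ, Finset.mem_image]
    refine ⟨(t : ℤ) + 1, by rw [Finset.mem_Icc]; omega, ?_⟩
    have : (2 * ((t : ℤ) + 1) - 1 : ℤ) = (q : ℤ) := by omega
    rw [this]; simp
  have key : Z ∩ Z.image (fun z => -(q : ZMod (q ^ 2 - 1)) * z) =
      {(-1 : ZMod (q ^ 2 - 1)), (q : ZMod (q ^ 2 - 1))} := by
    ext x
    rw [Finset.mem_inter, Finset.mem_insert, Finset.mem_singleton]
    constructor
    · rintro ⟨hx, hx'⟩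
      rw [Finset.mem_image] at hx'
      obtain ⟨y, hy, hyx⟩ := hx'
      rw [hZ, Finset.mem_image] at hx hy
      obtain ⟨i, hi, rfl⟩ := hx
      obtain ⟨j, hj, rfl⟩ := hy
      rw [Finset.mem_Icc] at hi hj
      have h : (((2 * i - 1) + (q : ℤ) * (2 * j - 1) : ℤ) : ZMod (q ^ 2 - 1)) = 0 := by
        push_cast at hyx ⊢
        rw [← hyx]; ring
      rw [ZMod.intCast_eq_zero_iff_aux, hcast] at h
      obtain ⟨k, hk⟩ := h
      have hqt : (q : ℤ) = 2 * t + 1 := by omega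
      have i1 : -((q : ℤ) - 2) ≤ 2 * i - 1 := by omega
      have i2 : 2 * i - 1 ≤ 2 * (q : ℤ) - 3 := by omega
      have j1 : -((q : ℤ) - 2) ≤ 2 * j - 1 := by omega
      have j2 : 2 * j - 1 ≤ 2 * (q : ℤ) - 3 := by omega
      rcases aux_arith q t i j k hq5 hqt i1 i2 j1 j2 hk with h | h
      · left
        rw [h]; simp
      · right
        rw [h]; simp
    · rintro (rfl | rfl)
      · refine ⟨hm1, Finset.mem_image.mpr ⟨_, hqZ, ?_⟩⟩
        linear_combination -hqq
      · exact ⟨hqZ, Finset.mem_image.mpr ⟨_, hm1, by ring⟩⟩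
  refine ⟨key, ?_⟩
  rw [key]
  apply Finset.card_pair
  intro h
  have h' : (((q : ℤ) + 1 : ℤ) : ZMod (q ^ 2 - 1)) = 0 := by
    push_cast
    rw [← h]; ring
  rw [ZMod.intCast_eq_zero_iff_aux, hcast] at h'
  have := Int.le_of_dvd (by omega) h'
  nlinarith
end

section
/- Let q be an odd prime power, set n = (q^2−1)/2, let F be a finite field with q^2 elements, and let η ∈ F be a primitive (q^2−1)-th root of unity (a generator of the multiplicative group of F). Let δ₁ and δ₂ be integers with 1 ≤ δ₁ ≤ (q−1)/2 − 1 and (q+1)/2 ≤ δ₂ ≤ q−1, and let Z = {(2j−1) mod (q^2−1) : −δ₁ ≤ j ≤ δ₂} ⊆ ℤ/(q^2−1)ℤ. Let H be the matrix over F with rows indexed by Z and columns indexed by j ∈ {0,1,…,n−1}, whose (z,j) entry is η^{z·j}. Then the rank of H·H† equals 2. -/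
open Matrix

theorem aux_sum {F : Type*} [Field F] (η : F) (n N : ℕ) (hn : 2 * n = N)
    (hη : IsPrimitiveRoot η N) (v : ℕ) (hv : 2 ∣ v) :
    ∑ j : Fin n, (η ^ v) ^ (j : ℕ) = if N ∣ v then (n : F) else 0 := by
  have hx : (η ^ v) ^ n = 1 := by
    obtain ⟨c, rfl⟩ := hv
    rw [← pow_mul, hη.pow_eq_one_iff_dvd]
    exact ⟨c, by rw [← hn]; ring⟩
  rw [Fin.sum_univ_eq_sum_range (fun j => (η ^ v) ^ j) n]
  split_ifs with h
  · rw [(hη.pow_eq_one_iff_dvd v).2 h]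
    simp
  · have h1 : η ^ v ≠ 1 := fun h' => h ((hη.pow_eq_one_iff_dvd v).1 h')
    rw [geom_sum_eq h1, hx]
    simp

theorem aux_arith_s12 (q z w k : ℤ) (h3 : 5 ≤ q) (hq : q % 2 = 1) (hz : z % 2 = 1)
    (z1 : -(q - 2) ≤ z) (z2 : z ≤ 2 * q - 3)
    (w1 : -(q - 2) ≤ w) (w2 : w ≤ 2 * q - 3) (h : z + q * w = (q ^ 2 - 1) * k) :
    (z = q ∧ w = -1) ∨ (z = -1 ∧ w = q) := by
  have k0 : -1 < k := by
    by_contra hk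
    nlinarith [mul_nonneg (by linarith : (0:ℤ) ≤ q) (by linarith : 0 ≤ w + (q - 2)),
      mul_nonneg (by nlinarith : (0:ℤ) ≤ q ^ 2 - 1) (by linarith : 0 ≤ -1 - k)]
  have k1 : k < 2 := by
    by_contra hk
    nlinarith [mul_nonneg (by linarith : (0:ℤ) ≤ q) (by linarith : 0 ≤ 2 * q - 3 - w),
      mul_nonneg (by nlinarith : (0:ℤ) ≤ q ^ 2 - 1) (by linarith : 0 ≤ k - 2)]
  have : k = 0 ∨ k = 1 := by omega
  rcases this with rfl | rfl
  · left
    have hz' : z = q * (-w) := by linarith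
    have a1 : -w < 2 := by
      by_contra hh
      nlinarith [mul_nonneg (by linarith : (0:ℤ) ≤ q) (by linarith : 0 ≤ -w - 2)]
    have a2 : -1 < -w := by
      by_contra hh
      nlinarith [mul_nonneg (by linarith : (0:ℤ) ≤ q) (by linarith : 0 ≤ -1 + w)]
    have : w = 0 ∨ w = -1 := by omega
    rcases this with rfl | rfl
    · omega
    · exact ⟨by linarith, rfl⟩
  · right
    have hz' : z + 1 = q * (q - w) := by linarith
    have a1 : q - w < 2 := by
      by_contra hh
      nlinarith [mul_nonneg (by linarith : (0:ℤ) ≤ q) (by linarith : 0 ≤ q - w - 2)]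
    have a2 : -1 < q - w := by
      by_contra hh
      nlinarith [mul_nonneg (by linarith : (0:ℤ) ≤ q) (by linarith : 0 ≤ -1 - (q - w))]
    have : q - w = 0 ∨ q - w = 1 := by omega
    rcases this with h | h
    · rw [h] at hz'
      omega
    · rw [h] at hz'
      omega

theorem aux_rank {ι F : Type*} [Fintype ι] [DecidableEq ι] [Field F] (M : Matrix ι ι F) (c : F)
    (hc : c ≠ 0) (a b : ι) (hab : a ≠ b)
    (hM : ∀ z w, M z w = if (z = a ∧ w = b) ∨ (z = b ∧ w = a) then c else 0) : M.rank = 2 := by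
  classical
  have hE : M = (Matrix.diagonal (fun i => if i = a ∨ i = b then c else 0)).submatrix
      (Equiv.refl ι) (Equiv.swap a b) := by
    ext z w
    rw [hM, Matrix.submatrix_apply, Matrix.diagonal_apply]
    simp only [Equiv.refl_apply, Equiv.swap_apply_def]
    split_ifs <;> grind
  rw [hE, Matrix.rank_submatrix, Matrix.rank_diagonal]
  rw [Fintype.card_subtype]
  have : (Finset.univ.filter fun i => (if i = a ∨ i = b then c else 0) ≠ 0) = {a, b} := by
    ext i
    simp [hc]
    tauto
  rw [this, Finset.card_pair hab]

/-- Let `q` be an odd prime power, `n = (q² - 1)/2`, `F` a finite field with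
`q²` elements, `η ∈ F` a primitive `(q² - 1)`-th root of unity, `1 ≤ δ₁ ≤ (q-1)/2 - 1`,
`(q+1)/2 ≤ δ₂ ≤ q - 1`, and `Z = {(2j-1) mod (q² - 1) : -δ₁ ≤ j ≤ δ₂}`.  Let `H` be the
matrix with rows indexed by `Z` and columns by `{0, …, n-1}` whose `(z, j)` entry is
`η^(z·j)`.  Then `rank (H·H†) = 2`. -/
theorem stmt12 (q : ℕ) (hq : IsPrimePow q) (hodd : Odd q)
    (n : ℕ) (hn : 2 * n = q ^ 2 - 1)
    (F : Type*) [Field F] [Fintype F] (hF : Fintype.card F = q ^ 2)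
    (η : F) (hη : IsPrimitiveRoot η (q ^ 2 - 1))
    (δ₁ δ₂ : ℕ) (h11 : 1 ≤ δ₁) (h12 : (δ₁ : ℤ) ≤ ((q : ℤ) - 1) / 2 - 1)
    (h21 : ((q : ℤ) + 1) / 2 ≤ (δ₂ : ℤ)) (h22 : δ₂ ≤ q - 1)
    (Z : Finset (ZMod (q ^ 2 - 1)))
    (hZ : Z = (Finset.Icc (-(δ₁ : ℤ)) (δ₂ : ℤ)).image
      (fun (j : ℤ) => ((2 * j - 1 : ℤ) : ZMod (q ^ 2 - 1))))
    (H : Matrix ↥Z (Fin n) F)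
    (hH : ∀ (z : ↥Z) (j : Fin n),
      H z j = η ^ ((z.1 * ((j : ℕ) : ZMod (q ^ 2 - 1))).val)) :
    (H * (H.map (fun x => x ^ q))ᵀ).rank = 2 := by
  classical
  have hq5 : 5 ≤ q := by omega
  have hqo : q % 2 = 1 := Nat.odd_iff.1 hodd
  have hqq : 25 ≤ q ^ 2 := by nlinarith
  have hNz : ((q ^ 2 - 1 : ℕ) : ℤ) = (q : ℤ) ^ 2 - 1 := by
    rw [Nat.cast_sub (by omega)]; push_cast; ring
  have hqN : q + 1 < q ^ 2 - 1 := by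
    have : q ^ 2 = q * q := sq q
    have : 5 * q ≤ q * q := Nat.mul_le_mul_right q hq5
    omega
  subst hZ
  generalize hNN : q ^ 2 - 1 = N at *
  haveI : NeZero N := ⟨by omega⟩
  have hnF : (n : F) ≠ 0 := by
    intro h0
    have h1 : ((Fintype.card F : ℕ) : F) = 0 := Nat.cast_card_eq_zero F
    have h2 : Fintype.card F = 2 * n + 1 := by omega
    rw [h2] at h1
    push_cast at h1
    rw [h0] at h1
    simp at h1
  have hmem : ∀ z : ZMod N, z ∈ (Finset.Icc (-(δ₁ : ℤ)) (δ₂ : ℤ)).image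
      (fun (j : ℤ) => ((2 * j - 1 : ℤ) : ZMod N)) →
      ∃ t : ℤ, t % 2 = 1 ∧ -((q:ℤ) - 2) ≤ t ∧ t ≤ 2 * q - 3 ∧ z = (t : ZMod N) := by
    intro z hz
    rw [Finset.mem_image] at hz
    obtain ⟨j, hj, rfl⟩ := hz
    rw [Finset.mem_Icc] at hj
    exact ⟨2 * j - 1, by omega, by omega, by omega, rfl⟩
  have hpow : ∀ a b : ℕ, ((a : ZMod N) = b) → η ^ a = η ^ b := by
    intro a b hab
    rw [ZMod.natCast_eq_natCast_iff] at hab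
    have : η ^ N = 1 := hη.pow_eq_one
    rw [← Nat.mod_add_div a N, ← Nat.mod_add_div b N, hab]
    simp [pow_add, pow_mul, this]
  have ha : ((q : ℕ) : ZMod N) ∈ (Finset.Icc (-(δ₁ : ℤ)) (δ₂ : ℤ)).image
      (fun (j : ℤ) => ((2 * j - 1 : ℤ) : ZMod N)) := by
    rw [Finset.mem_image]
    refine ⟨((q : ℤ) + 1) / 2, ?_, ?_⟩
    · rw [Finset.mem_Icc]; omega
    · have : 2 * (((q : ℤ) + 1) / 2) - 1 = q := by omega
      simp only [this]
      simp
  have hb : (-1 : ZMod N) ∈ (Finset.Icc (-(δ₁ : ℤ)) (δ₂ : ℤ)).image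
      (fun (j : ℤ) => ((2 * j - 1 : ℤ) : ZMod N)) := by
    rw [Finset.mem_image]
    refine ⟨0, ?_, ?_⟩
    · rw [Finset.mem_Icc]; omega
    · simp
  have hqq1 : (q : ZMod N) * q = 1 := by
    have : ((N : ℤ) : ZMod N) = (((q : ℤ) ^ 2 - 1 : ℤ) : ZMod N) := by rw [hNz]
    push_cast at this
    rw [ZMod.natCast_self] at this
    linear_combination -this
  refine aux_rank _ (n : F) hnF ⟨_, ha⟩ ⟨_, hb⟩ ?_ ?_
  · intro h
    have h : ((q : ℕ) : ZMod N) = -1 := congrArg Subtype.val h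
    have h' : ((q + 1 : ℕ) : ZMod N) = 0 := by push_cast; rw [h]; ring
    rw [ZMod.natCast_eq_zero_iff] at h'
    have := Nat.le_of_dvd (by omega) h'
    omega
  · rintro ⟨z, hz⟩ ⟨w, hw⟩
    obtain ⟨s, s0, s1, s2, hs⟩ := hmem z hz
    obtain ⟨t, t0, t1, t2, ht⟩ := hmem w hw
    have hval : ∀ (x : ZMod N) (r : ℤ), r % 2 = 1 → x = (r : ZMod N) → x.val % 2 = 1 := by
      intro x r hr hx
      have h1 : ((x.val : ℤ) : ZMod N) = (r : ZMod N) := by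
        rw [← hx]; simp
      rw [ZMod.intCast_eq_intCast_iff_dvd_sub] at h1
      have h2 : (2 : ℤ) ∣ r - x.val := dvd_trans ⟨n, by exact_mod_cast hn.symm⟩ h1
      omega
    have hzv := hval z s s0 hs
    have hwv := hval w t t0 ht
    have hev : 2 ∣ z.val + q * w.val := by
      have := Nat.odd_mul.2 ⟨hodd, Nat.odd_iff.2 hwv⟩
      rw [Nat.odd_iff] at this
      omega
    have hsum := aux_sum η n N hn hη _ hev
    have hent : (H * (H.map (fun x => x ^ q))ᵀ) ⟨z, hz⟩ ⟨w, hw⟩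
        = ∑ j : Fin n, (η ^ (z.val + q * w.val)) ^ (j : ℕ) := by
      rw [Matrix.mul_apply]
      refine Finset.sum_congr rfl fun j _ => ?_
      rw [Matrix.transpose_apply, Matrix.map_apply, hH, hH, ← pow_mul, ← pow_add, ← pow_mul]
      apply hpow
      push_cast
      simp only [ZMod.natCast_zmod_val]
      ring
    rw [hent, hsum]
    refine if_congr ?_ rfl rfl
    rw [← ZMod.natCast_eq_zero_iff]
    push_cast
    simp only [ZMod.natCast_zmod_val, Subtype.mk.injEq]
    constructor
    · intro h
      rw [hs, ht] at h
      have h' : ((s + q * t : ℤ) : ZMod N) = 0 := by push_cast; exact h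
      rw [ZMod.intCast_zmod_eq_zero_iff_dvd, hNz] at h'
      obtain ⟨k, hk⟩ := h'
      rcases aux_arith_s12 q s t k (by omega) (by omega) s0 s1 s2 t1 t2 hk with ⟨e1, e2⟩ | ⟨e1, e2⟩
      · left; rw [hs, ht, e1, e2]; simp
      · right; rw [hs, ht, e1, e2]; simp
    · rintro (⟨rfl, rfl⟩ | ⟨rfl, rfl⟩)
      · ring
      · rw [hqq1]; ring
end

section
/- Let q be an odd prime power, set n = (q^2−1)/2, let F be a finite field with q^2 elements, and let η ∈ F be a primitive (q^2−1)-th root of unity. Let δ₁ and δ₂ be integers with 0 ≤ δ₁ ≤ (q−1)/2 − 1 and (q+1)/2 ≤ δ₂ ≤ q−1, and let Z = {(2j−1) mod (q^2−1) : −δ₁ ≤ j ≤ δ₂}. Let C = {c ∈ F^n : for all z ∈ Z, Σ_{j=0}^{n−1} c_j·η^{z·j} = 0}. Then dim_F C = n − (δ₁+δ₂+1) and every nonzero codeword of C has Hamming weight at least δ₁+δ₂+2 (so C is an MDS code with parameters [n, n−δ₁−δ₂−1, δ₁+δ₂+2] over F). -/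
lemma weight_aux {F : Type*} [Field F] {n D : ℕ} (x v : Fin n → F) (hx : Function.Injective x)
    (hv : ∀ j, v j ≠ 0) (c : Fin n → F) (hc0 : c ≠ 0)
    (hc : ∀ i < D, ∑ j, c j * (v j * x j ^ i) = 0) :
    D + 1 ≤ {j : Fin n | c j ≠ 0}.ncard := by
  classical
  by_contra hlt
  have hset : {j : Fin n | c j ≠ 0} = ((Finset.univ.filter (fun j => c j ≠ 0) : Finset (Fin n)) : Set (Fin n)) := by
    ext; simp
  rw [hset, Set.ncard_coe_finset] at hlt
  set S := Finset.univ.filter (fun j => c j ≠ 0) with hS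
  obtain ⟨j0, hj0⟩ : ∃ j, c j ≠ 0 := by
    by_contra h
    push Not at h
    exact hc0 (funext h)
  have hj0S : j0 ∈ S := by simp [hS, hj0]
  have hpoly : ∀ p : Polynomial F, p.natDegree < D → ∑ j, c j * (v j * p.eval (x j)) = 0 := by
    intro p hp
    have : ∀ j, c j * (v j * p.eval (x j)) =
        ∑ i ∈ Finset.range D, p.coeff i * (c j * (v j * x j ^ i)) := by
      intro j
      rw [Polynomial.eval_eq_sum_range' hp, Finset.mul_sum, Finset.mul_sum]
      exact Finset.sum_congr rfl fun i _ => by ring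
    simp_rw [this]
    rw [Finset.sum_comm]
    refine Finset.sum_eq_zero fun i hi => ?_
    rw [← Finset.mul_sum, hc i (Finset.mem_range.1 hi), mul_zero]
  set p : Polynomial F := ∏ j ∈ S.erase j0, (Polynomial.X - Polynomial.C (x j)) with hp
  have hdeg : p.natDegree = S.card - 1 := by
    rw [hp, Polynomial.natDegree_finsetProd_X_sub_C_eq_card, Finset.card_erase_of_mem hj0S]
  have hpos : 0 < S.card := Finset.card_pos.2 ⟨j0, hj0S⟩
  have h := hpoly p (by omega)
  rw [Finset.sum_eq_single j0] at h
  · have hne : p.eval (x j0) ≠ 0 := by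
      rw [hp, Polynomial.eval_prod, Finset.prod_ne_zero_iff]
      intro j hj
      simp only [Polynomial.eval_sub, Polynomial.eval_X, Polynomial.eval_C]
      exact sub_ne_zero.2 fun e => (Finset.mem_erase.1 hj).1 (hx e).symm
    exact mul_ne_zero hj0 (mul_ne_zero (hv j0) hne) h
  · intro j _ hj
    by_cases hcj : c j = 0
    · simp [hcj]
    · have : p.eval (x j) = 0 := by
        rw [hp, Polynomial.eval_prod]
        exact Finset.prod_eq_zero (i := j) (by simp [hS, hj, hcj]) (by simp)
      simp [this]
  · simp

lemma dim_aux {F : Type*} [Field F] {n D : ℕ} (x v : Fin n → F) (hx : Function.Injective x)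
    (hv : ∀ j, v j ≠ 0) (hD : D ≤ n) (C : Submodule F (Fin n → F))
    (hC : ∀ c, c ∈ C ↔ ∀ i < D, ∑ j, c j * (v j * x j ^ i) = 0) :
    Module.finrank F C = n - D := by
  classical
  let A : (Fin n → F) →ₗ[F] (Fin D → F) :=
    { toFun := fun c i => ∑ j, c j * (v j * x j ^ (i : ℕ))
      map_add' := by intro a b; ext i; simp [add_mul, Finset.sum_add_distrib]
      map_smul' := by intro a b; ext i; simp [Finset.mul_sum, mul_assoc] }
  have hker : A.ker = C := by
    ext c
    rw [LinearMap.mem_ker, hC]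
    constructor
    · intro h i hi
      exact congrFun h ⟨i, hi⟩
    · intro h
      ext i
      exact h i i.2
  let B : (Fin D → F) →ₗ[F] (Fin D → F) :=
    { toFun := fun c i => ∑ j, c j * (v (Fin.castLE hD j) * x (Fin.castLE hD j) ^ (i : ℕ))
      map_add' := by intro a b; ext i; simp [add_mul, Finset.sum_add_distrib]
      map_smul' := by intro a b; ext i; simp [Finset.mul_sum, mul_assoc] }
  have hBinj : Function.Injective B := by
    rw [← LinearMap.ker_eq_bot, LinearMap.ker_eq_bot']
    intro c hc
    by_contra h0
    have := weight_aux (D := D) (fun j => x (Fin.castLE hD j)) (fun j => v (Fin.castLE hD j))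
      (fun a b h => Fin.castLE_injective hD (hx h)) (fun j => hv _) c h0
      (fun i hi => congrFun hc ⟨i, hi⟩)
    have h2 := Set.ncard_le_card {j : Fin D | c j ≠ 0}
    rw [Nat.card_fin] at h2
    omega
  have hBsurj : Function.Surjective B := LinearMap.injective_iff_surjective.1 hBinj
  have hAsurj : Function.Surjective A := by
    intro y
    obtain ⟨c, rfl⟩ := hBsurj y
    refine ⟨fun j => if h : (j : ℕ) < D then c ⟨j, h⟩ else 0, ?_⟩
    ext i
    simp only [A, B, LinearMap.coe_mk, AddHom.coe_mk]
    symm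
    apply Finset.sum_of_injOn (Fin.castLE hD) (Fin.castLE_injective hD).injOn
    · simp
    · intro j _ hj
      have : ¬ (j : ℕ) < D := fun h => hj ⟨⟨j, h⟩, by simp, by ext; simp⟩
      simp [this]
    · intro j _
      simp
  have h := A.finrank_range_add_finrank_ker
  rw [hker, LinearMap.range_eq_top.2 hAsurj, finrank_top] at h
  simp at h
  omega

lemma pow_val_aux {F : Type*} [Field F] {N : ℕ} (hN : N ≠ 0) (η : F) (hη : IsPrimitiveRoot η N)
    (m : ℤ) : η ^ ((m : ZMod N).val) = η ^ m := by
  haveI : NeZero N := ⟨hN⟩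
  have h0 : η ≠ 0 := hη.ne_zero hN
  rw [← zpow_natCast, ZMod.val_intCast]
  conv_rhs => rw [← Int.emod_add_mul_ediv m N, zpow_add₀ h0, zpow_mul, zpow_natCast, hη.pow_eq_one,
    one_zpow, mul_one]

/-- Let `q` be an odd prime power, `n = (q² - 1)/2`, `F` a finite field with
`q²` elements, `η ∈ F` a primitive `(q² - 1)`-th root of unity, `0 ≤ δ₁ ≤ (q-1)/2 - 1`,
`(q+1)/2 ≤ δ₂ ≤ q - 1`, and `Z = {(2j-1) mod (q² - 1) : -δ₁ ≤ j ≤ δ₂}`.  Let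
`C = {c ∈ Fⁿ : ∀ z ∈ Z, Σⱼ cⱼ·η^(z·j) = 0}`.  Then `dim_F C = n - (δ₁ + δ₂ + 1)` and
every nonzero codeword of `C` has Hamming weight at least `δ₁ + δ₂ + 2`. -/
theorem stmt13 (q : ℕ) (hq : IsPrimePow q) (hodd : Odd q)
    (n : ℕ) (hn : 2 * n = q ^ 2 - 1)
    (F : Type*) [Field F] [Fintype F] (hF : Fintype.card F = q ^ 2)
    (η : F) (hη : IsPrimitiveRoot η (q ^ 2 - 1))
    (δ₁ δ₂ : ℕ) (h12 : (δ₁ : ℤ) ≤ ((q : ℤ) - 1) / 2 - 1)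
    (h21 : ((q : ℤ) + 1) / 2 ≤ (δ₂ : ℤ)) (h22 : δ₂ ≤ q - 1)
    (Z : Finset (ZMod (q ^ 2 - 1)))
    (hZ : Z = (Finset.Icc (-(δ₁ : ℤ)) (δ₂ : ℤ)).image
      (fun (j : ℤ) => ((2 * j - 1 : ℤ) : ZMod (q ^ 2 - 1))))
    (C : Submodule F (Fin n → F))
    (hC : ∀ c, c ∈ C ↔ ∀ z ∈ Z,
      ∑ j : Fin n, c j * η ^ ((z * ((j : ℕ) : ZMod (q ^ 2 - 1))).val) = 0) :
    Module.finrank F C = n - (δ₁ + δ₂ + 1) ∧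
    ∀ c ∈ C, c ≠ 0 → δ₁ + δ₂ + 2 ≤ {j : Fin n | c j ≠ 0}.ncard := by
  obtain ⟨k, hk⟩ := hodd
  have hk1 : 1 ≤ k := by
    rcases Nat.eq_zero_or_pos k with h | h
    · subst h
      simp at hk
      exact absurd (hk ▸ hq) not_isPrimePow_one
    · exact h
  have hn' : n = 2 * k * (k + 1) := by
    have : q ^ 2 = 2 * (2 * k * (k + 1)) + 1 := by rw [hk]; ring
    omega
  have hN : q ^ 2 - 1 ≠ 0 := by
    have : 0 < k * (k + 1) := by positivity
    rw [← hn, hn']; positivity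
  have hD : δ₁ + δ₂ + 1 ≤ n := by
    have h1 : δ₁ + δ₂ + 1 ≤ 3 * k := by omega
    nlinarith
  have h0 : η ≠ 0 := hη.ne_zero hN
  have hη2 : IsPrimitiveRoot (η ^ 2) n := hη.pow (Nat.pos_of_ne_zero hN) hn.symm
  let x : Fin n → F := fun j => (η ^ 2) ^ (j : ℕ)
  let v : Fin n → F := fun j => η ^ ((-(2 * (δ₁ : ℤ) + 1)) * (j : ℕ))
  have hx : Function.Injective x := fun a b h => Fin.ext (hη2.pow_inj a.2 b.2 h)
  have hv : ∀ j, v j ≠ 0 := fun j => zpow_ne_zero _ h0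
  have hC' : ∀ c, c ∈ C ↔ ∀ i < δ₁ + δ₂ + 1, ∑ j, c j * (v j * x j ^ i) = 0 := by
    intro c
    have key : ∀ (m : ℤ) (i : ℕ), m = (i : ℤ) - δ₁ →
        ∑ j : Fin n, c j * η ^ (((((2 * m - 1 : ℤ) : ZMod (q ^ 2 - 1))) *
          ((j : ℕ) : ZMod (q ^ 2 - 1))).val) = ∑ j, c j * (v j * x j ^ i) := by
      intro m i hm
      refine Finset.sum_congr rfl fun j _ => ?_
      have e : (((2 * m - 1 : ℤ) : ZMod (q ^ 2 - 1))) * ((j : ℕ) : ZMod (q ^ 2 - 1))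
          = (((2 * m - 1) * ((j : ℕ) : ℤ) : ℤ) : ZMod (q ^ 2 - 1)) := by push_cast; ring
      rw [e, pow_val_aux hN η hη]
      congr 1
      simp only [v, x]
      rw [← pow_mul, ← pow_mul, ← zpow_natCast, ← zpow_add₀ h0]
      congr 1
      rw [hm]; push_cast; ring
    rw [hC, hZ]
    constructor
    · intro h i hi
      rw [← key ((i : ℤ) - δ₁) i rfl]
      exact h _ (Finset.mem_image_of_mem _ (Finset.mem_Icc.2 ⟨by omega, by omega⟩))
    · intro h z hz
      obtain ⟨m, hm, rfl⟩ := Finset.mem_image.1 hz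
      rw [Finset.mem_Icc] at hm
      have := key m (m + δ₁).toNat (by omega)
      rw [this]
      exact h _ (by omega)
  exact ⟨dim_aux x v hx hv hD C hC',
    fun c hc hc0 => weight_aux x v hx hv c hc0 ((hC' c).1 hc)⟩
end

section
/- Let t ≥ 3 be an odd integer and let q be an odd prime power with t dividing q+1. Set m = ((t−1)(q−1)−2)/(2t) (an integer under these hypotheses). Then for all integers j, k with 1 ≤ j ≤ (t+1)(q+1)/(2t) − 2 and 1 ≤ k ≤ (t+1)(q+1)/(2t) − 2, the congruence 1 + t(m − j) ≡ −q(1 + t(m + k)) (mod q^2−1) holds if and only if there exists an integer x with 1 ≤ x ≤ (t−1)/2 such that j = k = x(q+1)/t. In particular, the number of such pairs (j,k) is exactly (t−1)/2. -/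
/-- Let `t ≥ 3` be odd, `q` an odd prime power with `t ∣ q + 1`, and
`m = ((t-1)(q-1) - 2)/(2t)` (an integer).  For all integers `j, k` with
`1 ≤ j, k ≤ (t+1)(q+1)/(2t) - 2`, the congruence
`1 + t(m - j) ≡ -q(1 + t(m + k)) (mod q² - 1)` holds iff there is an integer `x` with
`1 ≤ x ≤ (t-1)/2` and `j = k = x(q+1)/t`.  In particular the number of such pairs `(j, k)`
is exactly `(t-1)/2`. -/
theorem stmt14 (t q : ℕ) (ht3 : 3 ≤ t) (htodd : Odd t)
    (hq : IsPrimePow q) (hqodd : Odd q) (hdvd : t ∣ q + 1)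
    (m : ℤ) (hm : 2 * (t : ℤ) * m = ((t : ℤ) - 1) * ((q : ℤ) - 1) - 2) :
    (∀ j k : ℤ, 1 ≤ j → j ≤ ((t : ℤ) + 1) * ((q : ℤ) + 1) / (2 * t) - 2 →
      1 ≤ k → k ≤ ((t : ℤ) + 1) * ((q : ℤ) + 1) / (2 * t) - 2 →
      ((1 + t * (m - j) ≡ -(q : ℤ) * (1 + t * (m + k)) [ZMOD ((q : ℤ) ^ 2 - 1)]) ↔
        ∃ x : ℤ, 1 ≤ x ∧ x ≤ ((t : ℤ) - 1) / 2 ∧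
          j = x * ((q : ℤ) + 1) / t ∧ k = x * ((q : ℤ) + 1) / t)) ∧
    {p : ℤ × ℤ |
        1 ≤ p.1 ∧ p.1 ≤ ((t : ℤ) + 1) * ((q : ℤ) + 1) / (2 * t) - 2 ∧
        1 ≤ p.2 ∧ p.2 ≤ ((t : ℤ) + 1) * ((q : ℤ) + 1) / (2 * t) - 2 ∧
        (1 + t * (m - p.1) ≡ -(q : ℤ) * (1 + t * (m + p.2)) [ZMOD ((q : ℤ) ^ 2 - 1)])}.ncard
      = (t - 1) / 2 := by
  obtain ⟨s, hs⟩ := hdvd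
  obtain ⟨u, rfl⟩ := htodd
  have hse : Even s := by
    have h1 : Even ((2 * u + 1) * s) := by rw [← hs]; exact hqodd.add_one
    rcases Nat.even_mul.1 h1 with h | h
    · exact absurd h (by simp)
    · exact h
  obtain ⟨r, hr⟩ := hse
  have hr1 : 1 ≤ r := by
    rcases Nat.eq_zero_or_pos r with h | h
    · subst h; subst hr; simp at hs
    · exact h
  have hu1 : 1 ≤ u := by omega
  subst hr
  have hq' : (q : ℤ) = (2 * u + 1) * (2 * r) - 1 := by
    have : ((q + 1 : ℕ) : ℤ) = (((2 * u + 1) * (r + r) : ℕ) : ℤ) := by rw [hs]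
    push_cast at this
    linarith
  have hR : (1 : ℤ) ≤ r := by exact_mod_cast hr1
  have hU : (1 : ℤ) ≤ u := by exact_mod_cast hu1
  have hUR : (r : ℤ) ≤ u * r := by nlinarith
  push_cast at hm ⊢
  generalize (q : ℤ) = Q at *
  have hnat : 2 * u / 2 = u := by omega
  rw [hnat]
  have hB : (2 * (u : ℤ) + 1 + 1) * (Q + 1) / (2 * (2 * u + 1)) = (u + 1) * (2 * r) := by
    apply Int.ediv_eq_of_eq_mul_right (by positivity)
    rw [hq']; ring
  have hX : ∀ x : ℤ, x * (Q + 1) / (2 * (u : ℤ) + 1) = 2 * r * x := by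
    intro x
    apply Int.ediv_eq_of_eq_mul_right (by positivity)
    rw [hq']; ring
  have hT : (2 * (u : ℤ) + 1 - 1) / 2 = u := by omega
  have hm' : (2 * (u : ℤ) + 1) * m = u * (Q - 1) - 1 := by linarith
  simp only [hB, hX, hT]
  have key : ∀ j k : ℤ, 1 ≤ j → j ≤ (u + 1) * (2 * r) - 2 → 1 ≤ k →
      k ≤ (u + 1) * (2 * r) - 2 →
      ((1 + (2 * (u : ℤ) + 1) * (m - j) ≡ -Q * (1 + (2 * (u : ℤ) + 1) * (m + k))
        [ZMOD (Q ^ 2 - 1)]) ↔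
        ∃ x : ℤ, 1 ≤ x ∧ x ≤ (u : ℤ) ∧ j = 2 * r * x ∧ k = 2 * r * x) := by
    intro j k hj1 hj2 hk1 hk2
    rw [Int.modEq_iff_dvd]
    have e : -Q * (1 + (2 * (u : ℤ) + 1) * (m + k)) - (1 + (2 * (u : ℤ) + 1) * (m - j))
        = -(u * (Q ^ 2 - 1)) - (2 * u + 1) * (Q * k - j) := by
      linear_combination (-Q - 1) * hm'
    have hQ1 : 0 < Q - 1 := by rw [hq']; nlinarith
    constructor
    · rintro ⟨c, hc⟩
      rw [e] at hc
      have h1 : (2 * (u : ℤ) + 1) * (Q * k - j) =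
          (2 * u + 1) * (2 * r * (Q - 1) * (-c - u)) := by
        linear_combination -hc + (-c - u) * (Q - 1) * hq'
      have h2 := mul_left_cancel₀ (by positivity) h1
      have h3 : (Q - 1) ∣ (k - j) := ⟨2 * r * (-c - u) - k, by linear_combination h2⟩
      have h4 : k - j = 0 := by
        apply Int.eq_zero_of_abs_lt_dvd h3
        rw [abs_lt]
        constructor <;> rw [hq'] <;> nlinarith
      have hkj : j = k := by omega
      subst hkj
      have h5 : (Q - 1) * j = (Q - 1) * (2 * r * (-c - u)) := by linear_combination h2
      have h6 := mul_left_cancel₀ hQ1.ne' h5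
      refine ⟨-c - u, ?_, ?_, h6, h6⟩
      · by_contra h; nlinarith
      · by_contra h; nlinarith
    · rintro ⟨x, hx1, hx2, rfl, rfl⟩
      rw [e]
      refine ⟨-u - x, ?_⟩
      linear_combination x * (Q - 1) * hq'
  refine ⟨key, ?_⟩
  have hset : {p : ℤ × ℤ | 1 ≤ p.1 ∧ p.1 ≤ (u + 1) * (2 * r) - 2 ∧ 1 ≤ p.2 ∧
      p.2 ≤ (u + 1) * (2 * r) - 2 ∧
      (1 + (2 * (u : ℤ) + 1) * (m - p.1) ≡ -Q * (1 + (2 * (u : ℤ) + 1) * (m + p.2))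
        [ZMOD (Q ^ 2 - 1)])} =
      ((Finset.Icc (1 : ℤ) u).image (fun x : ℤ => ((2 * r * x, 2 * r * x) : ℤ × ℤ)) :
        Finset (ℤ × ℤ)) := by
    ext ⟨j, k⟩
    simp only [Set.mem_setOf_eq, Finset.coe_image, Set.mem_image, Finset.coe_Icc, Set.mem_Icc,
      Prod.mk.injEq]
    constructor
    · rintro ⟨a, b, c, d, h⟩
      obtain ⟨x, h1, h2, h3, h4⟩ := (key j k a b c d).1 h
      exact ⟨x, ⟨h1, h2⟩, h3.symm, h4.symm⟩
    · rintro ⟨x, ⟨h1, h2⟩, h3, h4⟩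
      have a : 1 ≤ 2 * r * x := by nlinarith
      have b : 2 * r * x ≤ (u + 1) * (2 * r) - 2 := by nlinarith
      subst h3; subst h4
      exact ⟨a, b, a, b, (key _ _ a b a b).2 ⟨x, h1, h2, rfl, rfl⟩⟩
  rw [hset, Set.ncard_coe_finset, Finset.card_image_of_injective]
  · simp
  · intro x y h
    simp only [Prod.mk.injEq] at h
    exact mul_left_cancel₀ (by positivity) h.1
end

section
/- Let t ≥ 3 be an odd integer, let q be an odd prime power with t dividing q+1, and set N = q^2−1 and m = ((t−1)(q−1)−2)/(2t). Let δ₁ and δ₂ be integers with (t−1)(q+1)/(2t) ≤ δ₁ ≤ (t+1)(q+1)/(2t) − 2 and (t−1)(q+1)/(2t) ≤ δ₂ ≤ (t+1)(q+1)/(2t) − 2, and let Z = {(1 + t(m+i)) mod N : −δ₁ ≤ i ≤ δ₂} ⊆ ℤ/Nℤ. Then the intersection Z ∩ {−q·z : z ∈ Z} has exactly t elements. -/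
/-- Let `t ≥ 3` be odd, `q` an odd prime power with `t ∣ q + 1`, `N = q² - 1`,
`m = ((t-1)(q-1) - 2)/(2t)`, and let `δ₁, δ₂` satisfy
`(t-1)(q+1)/(2t) ≤ δᵢ ≤ (t+1)(q+1)/(2t) - 2`.  Let
`Z = {(1 + t(m+i)) mod N : -δ₁ ≤ i ≤ δ₂} ⊆ ℤ/Nℤ`.  Then `Z ∩ (-q)·Z` has exactly
`t` elements. -/
theorem stmt15 (t q : ℕ) (ht3 : 3 ≤ t) (htodd : Odd t)
    (hq : IsPrimePow q) (hqodd : Odd q) (hdvd : t ∣ q + 1)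
    (m : ℤ) (hm : 2 * (t : ℤ) * m = ((t : ℤ) - 1) * ((q : ℤ) - 1) - 2)
    (δ₁ δ₂ : ℕ)
    (h11 : ((t : ℤ) - 1) * ((q : ℤ) + 1) / (2 * t) ≤ (δ₁ : ℤ))
    (h12 : (δ₁ : ℤ) ≤ ((t : ℤ) + 1) * ((q : ℤ) + 1) / (2 * t) - 2)
    (h21 : ((t : ℤ) - 1) * ((q : ℤ) + 1) / (2 * t) ≤ (δ₂ : ℤ))
    (h22 : (δ₂ : ℤ) ≤ ((t : ℤ) + 1) * ((q : ℤ) + 1) / (2 * t) - 2)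
    (Z : Finset (ZMod (q ^ 2 - 1)))
    (hZ : Z = (Finset.Icc (-(δ₁ : ℤ)) (δ₂ : ℤ)).image
      (fun (i : ℤ) => ((1 + t * (m + i) : ℤ) : ZMod (q ^ 2 - 1)))) :
    (Z ∩ Z.image (fun z => -(q : ZMod (q ^ 2 - 1)) * z)).card = t := by
  obtain ⟨s, rfl⟩ := htodd
  obtain ⟨c, hc⟩ := hdvd
  have hce : Even c := by
    have h1 : Even ((2 * s + 1) * c) := by rw [← hc]; exact hqodd.add_one
    rcases Nat.even_mul.1 h1 with h | h
    · exact absurd h (by simp [parity_simps])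
    · exact h
  obtain ⟨k, rfl⟩ := hce
  have hs : 1 ≤ s := by omega
  have hk : 1 ≤ k := by
    rcases Nat.eq_zero_or_pos k with h | h
    · subst h; simp at hc
    · exact h
  have hQ : (q : ℤ) = 2 * (2 * s + 1) * k - 1 := by
    have : ((q + 1 : ℕ) : ℤ) = (((2 * s + 1) * (k + k) : ℕ) : ℤ) := by rw [hc]
    push_cast at this
    linarith
  have hN : ((q ^ 2 - 1 : ℕ) : ℤ) = (2 * s + 1) * (2 * k * ((q : ℤ) - 1)) := by
    have h1 : 1 ≤ q ^ 2 := Nat.one_le_pow _ _ (by have := hq.pos; omega)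
    rw [Nat.cast_sub h1]
    push_cast
    rw [hQ]; ring
  generalize q ^ 2 - 1 = N at *
  have hs' : (1 : ℤ) ≤ s := by exact_mod_cast hs
  have hk' : (1 : ℤ) ≤ k := by exact_mod_cast hk
  push_cast at *
  have e1 : ((2 * (s : ℤ) + 1) - 1) * ((q : ℤ) + 1) / (2 * (2 * s + 1)) = 2 * (s * k) := by
    apply Int.ediv_eq_of_eq_mul_right (by positivity)
    rw [hQ]; ring
  have e2 : ((2 * (s : ℤ) + 1) + 1) * ((q : ℤ) + 1) / (2 * (2 * s + 1)) = 2 * (s * k) + 2 * k := by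
    apply Int.ediv_eq_of_eq_mul_right (by positivity)
    rw [hQ]; ring
  rw [e1] at h11 h21
  rw [e2] at h12 h22
  have hm' : m = 2 * (s * k) - 1 := by
    have : (2 * (2 * (s : ℤ) + 1)) ≠ 0 := by positivity
    apply mul_left_cancel₀ this
    rw [hm, hQ]; ring
  have hsk : (s : ℤ) ≤ s * k := by nlinarith
  have hq1 : (q : ℤ) - 1 = 4 * (s * k) + 2 * k - 2 := by rw [hQ]; ring
  have hqpos : 0 < (q : ℤ) - 1 := by linarith
  have key : Z ∩ Z.image (fun z => -(q : ZMod N) * z) =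
      (Finset.Icc (-(s : ℤ)) s).image
        (fun l : ℤ => ((1 + (2 * s + 1) * (m + 2 * k * l) : ℤ) : ZMod N)) := by
    ext x
    simp only [hZ, Finset.mem_inter, Finset.mem_image, Finset.mem_Icc]
    constructor
    · rintro ⟨⟨i, ⟨hi1, hi2⟩, rfl⟩, z, ⟨j, ⟨hj1, hj2⟩, rfl⟩, hz⟩
      have hz' : ((-(q : ℤ) * (1 + (2 * s + 1) * (m + j)) : ℤ) : ZMod N)
          = ((1 + (2 * s + 1) * (m + i) : ℤ) : ZMod N) := by
        push_cast; push_cast at hz; exact hz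
      rw [ZMod.intCast_eq_intCast_iff_dvd_sub, hN] at hz'
      obtain ⟨w, hw⟩ := hz'
      have hT : (2 * (s : ℤ) + 1) ≠ 0 := by positivity
      have h3 : i + q * j = 2 * k * (q - 1) * (w - s) := by
        apply mul_left_cancel₀ hT
        rw [hm'] at hw
        have hQ2 : 2 * (2 * (s : ℤ) + 1) * k = q + 1 := by linarith
        linear_combination hw - 2 * s * hQ2
      generalize w - (s : ℤ) = l at h3
      have h4 : i + j = (q - 1) * (2 * k * l - j) := by linarith
      obtain ⟨r, hr⟩ : ∃ r, r = 2 * k * l - j := ⟨_, rfl⟩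
      rw [← hr] at h4
      have r1 : r < 2 := by
        by_contra h
        have : ((q : ℤ) - 1) * 2 ≤ (q - 1) * r := mul_le_mul_of_nonneg_left (by omega) hqpos.le
        linarith
      have r2 : -2 < r := by
        by_contra h
        have : ((q : ℤ) - 1) * r ≤ (q - 1) * (-2) := mul_le_mul_of_nonneg_left (by omega) hqpos.le
        linarith
      have r0 : r = 0 := by
        have h5 : r = 0 ∨ r = 1 ∨ r = -1 := by omega
        rcases h5 with h | h | h
        · exact h
        · exfalso
          subst h
          have a1 : l < s + 1 := by
            have : (k : ℤ) * l < k * (s + 1) := by linarith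
            exact lt_of_mul_lt_mul_left this (by positivity)
          have a2 : 2 * s + 1 - l < s + 1 := by
            have : (k : ℤ) * (2 * s + 1 - l) < k * (s + 1) := by linarith
            exact lt_of_mul_lt_mul_left this (by positivity)
          linarith
        · exfalso
          subst h
          have a1 : -l < s + 1 := by
            have : (k : ℤ) * (-l) < k * (s + 1) := by linarith
            exact lt_of_mul_lt_mul_left this (by positivity)
          have a2 : 2 * s + 1 + l < s + 1 := by
            have : (k : ℤ) * (2 * s + 1 + l) < k * (s + 1) := by linarith
            exact lt_of_mul_lt_mul_left this (by positivity)
          linarith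
      subst r0
      have hi : i = 2 * k * (-l) := by linarith
      have b1 : l < s + 1 := by
        have : (k : ℤ) * l < k * (s + 1) := by linarith
        exact lt_of_mul_lt_mul_left this (by positivity)
      have b2 : -l < s + 1 := by
        have : (k : ℤ) * (-l) < k * (s + 1) := by linarith
        exact lt_of_mul_lt_mul_left this (by positivity)
      exact ⟨-l, ⟨by omega, by omega⟩, by rw [hi]; push_cast; ring⟩
    · rintro ⟨l, ⟨hl1, hl2⟩, rfl⟩
      have c1 : (k : ℤ) * l ≤ k * s := mul_le_mul_of_nonneg_left hl2 (by positivity)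
      have c2 : (k : ℤ) * (-s) ≤ k * l := mul_le_mul_of_nonneg_left hl1 (by positivity)
      refine ⟨⟨2 * k * l, ⟨by linarith, by linarith⟩, by push_cast; ring⟩, _,
        ⟨2 * k * (-l), ⟨by linarith, by linarith⟩, rfl⟩, ?_⟩
      have hz' : ((-(q : ℤ) * (1 + (2 * s + 1) * (m + 2 * k * (-l))) : ℤ) : ZMod N)
          = ((1 + (2 * s + 1) * (m + 2 * k * l) : ℤ) : ZMod N) := by
        rw [ZMod.intCast_eq_intCast_iff_dvd_sub, hN]
        refine ⟨s - l, ?_⟩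
        rw [hm', hQ]; ring
      push_cast at hz' ⊢
      exact hz'
  rw [key, Finset.card_image_of_injOn]
  · simp; omega
  · intro a ha b hb hab
    simp only [Finset.coe_Icc, Set.mem_Icc] at ha hb
    simp only at hab
    rw [ZMod.intCast_eq_intCast_iff_dvd_sub, hN] at hab
    obtain ⟨w, hw⟩ := hab
    have hT : (2 * (s : ℤ) + 1) * (2 * k) ≠ 0 := by positivity
    have h3 : b - a = (q - 1) * w := by
      apply mul_left_cancel₀ hT
      linear_combination hw
    have hb' : 2 * (s : ℤ) < q - 1 := by linarith
    have h0 : b - a = 0 := by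
      apply Int.eq_zero_of_abs_lt_dvd ⟨w, h3⟩
      rw [abs_lt]; constructor <;> linarith [ha.1, ha.2, hb.1, hb.2]
    linarith
end

section
/- Let t ≥ 3 be an odd integer, let q be an odd prime power with t dividing q+1, set n = (q^2−1)/t and m = ((t−1)(q−1)−2)/(2t). Let F be a finite field with q^2 elements and let η ∈ F be a primitive (q^2−1)-th root of unity. Let δ₁ and δ₂ be integers with (t−1)(q+1)/(2t) ≤ δ₁ ≤ (t+1)(q+1)/(2t) − 2 and (t−1)(q+1)/(2t) ≤ δ₂ ≤ (t+1)(q+1)/(2t) − 2, and let Z = {(1 + t(m+i)) mod (q^2−1) : −δ₁ ≤ i ≤ δ₂}. Let H be the matrix over F with rows indexed by Z and columns indexed by j ∈ {0,1,…,n−1}, whose (z,j) entry is η^{z·j}. Then the rank of H·H† equals t. -/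
open Matrix

lemma key16 (t s u v : ℤ) (ht : 3 ≤ t) (hs : 2 ≤ s) (hu1 : 1 - s ≤ u) (hu2 : u ≤ t * s - 3)
    (hv1 : 1 - s ≤ v) (hv2 : v ≤ t * s - 3)
    (h : t * (s * (t * s - 2)) ∣ (1 + t * v) + (t * s - 1) * (1 + t * u)) :
    ∃ w : ℤ, 0 ≤ w ∧ w < t ∧ u = w * s - 1 ∧ v = (t - 1 - w) * s - 1 := by
  have h1 : s * (t * s - 2) ∣ s + v - u + t * s * u := by
    have e : (1 + t * v) + (t * s - 1) * (1 + t * u) = t * (s + v - u + t * s * u) := by ring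
    rw [e] at h
    exact Int.dvd_of_mul_dvd_mul_left (by omega) h
  obtain ⟨w, hw⟩ := h1
  have hc : ∃ c, v = u + s * c := ⟨(t * s - 2) * w - 1 - t * u, by linarith⟩
  obtain ⟨c, rfl⟩ := hc
  have h2 : 1 + c + t * u = (t * s - 2) * w := by
    apply mul_left_cancel₀ (show s ≠ 0 by omega)
    linarith
  have he : ∃ e, c = t * e - 1 - 2 * w := ⟨s * w - u, by linarith⟩
  obtain ⟨e, rfl⟩ := he
  have hu : u = w * s - e := by
    apply mul_left_cancel₀ (show t ≠ 0 by omega)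
    linarith
  subst hu
  obtain ⟨w', hw'⟩ : ∃ w', w' = t * e - w - 1 := ⟨_, rfl⟩
  have hv : w * s - e + s * (t * e - 1 - 2 * w) = w' * s - e := by rw [hw']; ring
  rw [hv] at hv1 hv2 ⊢
  have hts : 3 * s ≤ t * s := by nlinarith
  have hsum : (w + w') * s = (t * e - 1) * s := by rw [hw']; ring
  have e3 : e < 3 := by
    by_contra hh
    push Not at hh
    nlinarith [mul_nonneg (sub_nonneg.2 hh) (show 0 ≤ t * s - 2 by linarith)]
  have e0 : -1 < e := by
    by_contra hh
    push Not at hh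
    nlinarith [mul_nonneg (show 0 ≤ -1 - e by linarith) (show 0 ≤ t * s - 2 by linarith)]
  have hpos : ∀ x : ℤ, -s < x * s → 0 ≤ x := by
    intro x hx
    by_contra hh
    push Not at hh
    nlinarith
  have hlt : ∀ x : ℤ, x * s < t * s → x < t := by
    intro x hx
    exact lt_of_mul_lt_mul_right hx (by omega)
  have : e = 0 ∨ e = 1 ∨ e = 2 := by omega
  rcases this with rfl | rfl | rfl
  · have := hpos w (by linarith)
    have := hpos w' (by linarith)
    omega
  · have := hpos w (by linarith)
    have := hpos w' (by linarith)
    refine ⟨w, by omega, by omega, rfl, ?_⟩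
    rw [hw']; ring
  · have := hlt w (by linarith)
    have := hlt w' (by linarith)
    omega

lemma rank16 {Z F : Type*} [Fintype Z] [DecidableEq Z] [Field F] (t : ℕ) (M : Matrix Z Z F) (c : F)
    (hc : c ≠ 0) (f g : Fin t → Z) (hf : Function.Injective f) (hg : Function.Injective g)
    (h1 : ∀ w, M (f w) (g w) = c)
    (h2 : ∀ z z', (¬ ∃ w, z = f w ∧ z' = g w) → M z z' = 0) : M.rank = t := by
  apply le_antisymm
  · have : M = (Matrix.of fun z w => if z = f w then c else 0 : Matrix Z (Fin t) F) *
        (Matrix.of fun w z' => if z' = g w then 1 else 0 : Matrix (Fin t) Z F) := by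
      ext z z'
      rw [Matrix.mul_apply]
      by_cases h : ∃ w, z = f w ∧ z' = g w
      · obtain ⟨w, rfl, rfl⟩ := h
        rw [Finset.sum_eq_single w]
        · simp [h1]
        · intro b _ hb
          have : f w ≠ f b := fun h => hb (hf h).symm
          simp [this]
        · simp
      · rw [h2 _ _ h, Finset.sum_eq_zero]
        intro w _
        by_cases a : z = f w
        · have b : z' ≠ g w := fun b => h ⟨w, a, b⟩
          simp [b]
        · simp [a]
    rw [this]
    refine (Matrix.rank_mul_le_left _ _).trans ?_
    simpa using Matrix.rank_le_card_width (Matrix.of fun z w => if z = f w then c else 0 : Matrix Z (Fin t) F)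
  · have : M.submatrix f g = Matrix.diagonal (fun _ => c) := by
      ext w w'
      by_cases h : w = w'
      · subst h; simp [h1]
      · rw [Matrix.submatrix_apply, Matrix.diagonal_apply_ne _ h]
        apply h2
        rintro ⟨b, hb, hb'⟩
        exact h ((hf hb).trans (hg hb').symm)
    have h3 : (M.submatrix f g).rank = t := by
      classical
      rw [this, Matrix.rank_diagonal]
      simp [hc]
    have h4 := Matrix.rank_submatrix_le M f g
    omega

set_option maxHeartbeats 1000000 in
/-- Let `t ≥ 3` be odd, `q` an odd prime power with `t ∣ q + 1`,
`n = (q² - 1)/t`, `m = ((t-1)(q-1) - 2)/(2t)`, `F` a finite field with `q²` elements, and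
`η ∈ F` a primitive `(q² - 1)`-th root of unity.  Let `δ₁, δ₂` satisfy
`(t-1)(q+1)/(2t) ≤ δᵢ ≤ (t+1)(q+1)/(2t) - 2` and
`Z = {(1 + t(m+i)) mod (q² - 1) : -δ₁ ≤ i ≤ δ₂}`.  Let `H` be the matrix with rows
indexed by `Z` and columns by `{0, …, n-1}` whose `(z, j)` entry is `η^(z·j)`.
Then `rank (H·H†) = t`. -/
theorem stmt16 (t q : ℕ) (ht3 : 3 ≤ t) (htodd : Odd t)
    (hq : IsPrimePow q) (hqodd : Odd q) (hdvd : t ∣ q + 1)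
    (n : ℕ) (hn : t * n = q ^ 2 - 1)
    (m : ℤ) (hm : 2 * (t : ℤ) * m = ((t : ℤ) - 1) * ((q : ℤ) - 1) - 2)
    (F : Type*) [Field F] [Fintype F] (hF : Fintype.card F = q ^ 2)
    (η : F) (hη : IsPrimitiveRoot η (q ^ 2 - 1))
    (δ₁ δ₂ : ℕ)
    (h11 : ((t : ℤ) - 1) * ((q : ℤ) + 1) / (2 * t) ≤ (δ₁ : ℤ))
    (h12 : (δ₁ : ℤ) ≤ ((t : ℤ) + 1) * ((q : ℤ) + 1) / (2 * t) - 2)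
    (h21 : ((t : ℤ) - 1) * ((q : ℤ) + 1) / (2 * t) ≤ (δ₂ : ℤ))
    (h22 : (δ₂ : ℤ) ≤ ((t : ℤ) + 1) * ((q : ℤ) + 1) / (2 * t) - 2)
    (Z : Finset (ZMod (q ^ 2 - 1)))
    (hZ : Z = (Finset.Icc (-(δ₁ : ℤ)) (δ₂ : ℤ)).image
      (fun (i : ℤ) => ((1 + t * (m + i) : ℤ) : ZMod (q ^ 2 - 1))))
    (H : Matrix ↥Z (Fin n) F)
    (hH : ∀ (z : ↥Z) (j : Fin n),
      H z j = η ^ ((z.1 * ((j : ℕ) : ZMod (q ^ 2 - 1))).val)) :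
    (H * (H.map (fun x => x ^ q))ᵀ).rank = t := by
  obtain ⟨s, hs⟩ := hdvd
  have hq2 : 2 ≤ q := hq.two_le
  have hse : Even s := by
    have : Even (t * s) := by rw [← hs]; exact hqodd.add_one
    rcases Nat.even_mul.1 this with h | h
    · exact absurd h (Nat.not_even_iff_odd.2 htodd)
    · exact h
  obtain ⟨r, hr⟩ := htodd
  obtain ⟨s', rfl⟩ := hse
  have hs0 : 1 ≤ s' := by
    rcases Nat.eq_zero_or_pos s' with h | h
    · subst h; simp at hs
    · exact h
  have hqz : (q : ℤ) = t * (s' + s') - 1 := by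
    have : ((q + 1 : ℕ) : ℤ) = (t * (s' + s') : ℕ) := by rw [hs]
    push_cast at this; linarith
  have htz : (t : ℤ) = 2 * r + 1 := by exact_mod_cast hr
  have ht0 : (2 * t : ℤ) ≠ 0 := by positivity
  have hA : ((t : ℤ) - 1) * ((q : ℤ) + 1) / (2 * t) = (t - 1) * s' := by
    rw [hqz]; apply Int.ediv_eq_of_eq_mul_right ht0; ring
  have hB : ((t : ℤ) + 1) * ((q : ℤ) + 1) / (2 * t) = (t + 1) * s' := by
    rw [hqz]; apply Int.ediv_eq_of_eq_mul_right ht0; ring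
  rw [hA] at h11 h21
  rw [hB] at h12 h22
  have hm' : m = (t - 1) * s' - 1 := by
    apply mul_left_cancel₀ ht0
    rw [hm, hqz]; ring
  obtain ⟨s, hsd⟩ : ∃ s : ℤ, s = s' + s' := ⟨_, rfl⟩
  have hs2 : 2 ≤ s := by omega
  have ht3z : (3 : ℤ) ≤ t := by exact_mod_cast ht3
  rw [← hsd] at hqz
  obtain ⟨N, hN⟩ : ∃ N, N = q ^ 2 - 1 := ⟨_, rfl⟩
  have hq21 : N + 1 = q ^ 2 := by
    have : 1 ≤ q ^ 2 := Nat.one_le_pow _ _ (by omega)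
    omega
  rw [← hN] at hn hη
  have hNz : (N : ℤ) = t * (s * (t * s - 2)) := by
    have : ((N + 1 : ℕ) : ℤ) = (q ^ 2 : ℕ) := by rw [hq21]
    push_cast at this
    rw [hqz] at this
    linarith
  have hN1 : 1 ≤ N := by
    have : 2 ^ 2 ≤ q ^ 2 := Nat.pow_le_pow_left hq2 2
    omega
  revert Z
  rw [← hN]
  intro Z hZ H hH
  have : NeZero N := ⟨by omega⟩
  -- reparametrize
  have hZm : ∀ z, z ∈ Z ↔ ∃ u : ℤ, -(δ₁ : ℤ) ≤ u - m ∧ u - m ≤ δ₂ ∧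
      ((1 + t * u : ℤ) : ZMod N) = z := by
    intro z
    rw [hZ]
    simp only [Finset.mem_image, Finset.mem_Icc]
    constructor
    · rintro ⟨i, ⟨h1, h2⟩, h3⟩
      exact ⟨m + i, by linarith, by linarith, h3⟩
    · rintro ⟨u, h1, h2, h3⟩
      exact ⟨u - m, ⟨h1, h2⟩, by rw [← h3]; congr 2; ring⟩
  have hts : 3 * s ≤ t * s := by nlinarith
  have hmem : ∀ w : Fin t, ((1 + t * ((w : ℕ) * s - 1) : ℤ) : ZMod N) ∈ Z := by
    intro w
    rw [hZm]
    have hw : ((w : ℕ) : ℤ) + 1 ≤ t := by exact_mod_cast w.2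
    have h0 : (0 : ℤ) ≤ (w : ℕ) := by positivity
    have h1 : (0 : ℤ) ≤ (w : ℕ) * s := mul_nonneg h0 (by omega)
    have h2 : (((w : ℕ) : ℤ) + 1) * s ≤ t * s := mul_le_mul_of_nonneg_right hw (by omega)
    have b3 : ((t : ℤ) - 1) * s' + (t - 1) * s' = t * s - s := by rw [hsd]; ring
    refine ⟨(w : ℕ) * s - 1, ?_, ?_, rfl⟩
    · rw [hm']; linarith
    · rw [hm']; linarith
  have hinj : ∀ w w' : Fin t, ((1 + t * ((w : ℕ) * s - 1) : ℤ) : ZMod N) =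
      ((1 + t * ((w' : ℕ) * s - 1) : ℤ) : ZMod N) → w = w' := by
    intro w w' h
    rw [ZMod.intCast_eq_intCast_iff_dvd_sub] at h
    have e : (1 + t * ((w' : ℕ) * s - 1) : ℤ) - (1 + t * ((w : ℕ) * s - 1)) =
      t * (s * ((w' : ℕ) - (w : ℕ))) := by ring
    rw [e, hNz] at h
    have h := Int.dvd_of_mul_dvd_mul_left (by omega) (Int.dvd_of_mul_dvd_mul_left (by omega) h)
    have hw := w.2
    have hw' := w'.2
    have h3 : (t : ℤ) ≤ t * s - 2 := by nlinarith
    have := Int.eq_zero_of_abs_lt_dvd h (by rw [abs_lt]; constructor <;> omega)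
    ext; omega
  -- the condition
  have hcond : ∀ z z' : Z, z.1 + (q : ZMod N) * z'.1 = 0 → ∃ w : Fin t,
      z.1 = ((1 + t * ((w : ℕ) * s - 1) : ℤ) : ZMod N) ∧
      z'.1 = ((1 + t * ((w.rev : ℕ) * s - 1) : ℤ) : ZMod N) := by
    rintro ⟨z, hz⟩ ⟨z', hz'⟩ h
    rw [hZm] at hz hz'
    obtain ⟨u, h1, h2, rfl⟩ := hz
    obtain ⟨v, h3, h4, rfl⟩ := hz'
    dsimp only at h ⊢
    have h5 : (N : ℤ) ∣ (1 + t * u) + (t * s - 1) * (1 + t * v) := by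
      rw [← hqz, ← ZMod.intCast_zmod_eq_zero_iff_dvd]
      rw [← h]; push_cast; rfl
    rw [hNz] at h5
    rw [hm'] at h1 h2 h3 h4
    have b1 : δ₁ ≤ (t - 1) * s' + s - 2 := by linarith
    have b2 : δ₂ ≤ (t - 1) * s' + s - 2 := by linarith
    have b3 : ((t : ℤ) - 1) * s' + (t - 1) * s' = t * s - s := by rw [hsd]; ring
    obtain ⟨w, hw0, hwt, rfl, rfl⟩ := key16 t s v u ht3z hs2 (by linarith) (by linarith)
      (by linarith) (by linarith) h5
    lift w to ℕ using hw0
    have hwt : w < t := by exact_mod_cast hwt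
    refine ⟨(⟨w, hwt⟩ : Fin t).rev, ?_, ?_⟩
    · rw [Fin.val_rev]
      simp only
      rw [Nat.cast_sub (by omega)]
      congr 1; push_cast; ring
    · rw [Fin.rev_rev]
  have hcond' : ∀ w : Fin t, ((1 + t * ((w : ℕ) * s - 1) : ℤ) : ZMod N) + (q : ZMod N) *
      ((1 + t * ((w.rev : ℕ) * s - 1) : ℤ) : ZMod N) = 0 := by
    intro w
    have h5 : (N : ℤ) ∣ (1 + t * ((w : ℕ) * s - 1)) + q * (1 + t * ((w.rev : ℕ) * s - 1)) := by
      rw [hqz, hNz, Fin.val_rev, Nat.cast_sub (by omega)]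
      refine ⟨t - 1 - (w : ℕ), ?_⟩
      push_cast; ring
    rw [← ZMod.intCast_zmod_eq_zero_iff_dvd] at h5
    rw [← h5]; push_cast; rfl
  -- entries
  have hpow : ∀ (z : Z) (j : Fin n), H z j = η ^ (z.1.val * j) := by
    intro z j
    rw [hH]
    have : z.1 * ((j : ℕ) : ZMod N) = ((z.1.val * (j : ℕ) : ℕ) : ZMod N) := by
      push_cast; rw [ZMod.natCast_zmod_val]
    rw [this, ZMod.val_natCast]
    exact (pow_eq_pow_mod _ hη.pow_eq_one).symm
  have hval : ∀ z : Z, (t : ℤ) ∣ z.1.val - 1 := by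
    rintro ⟨z, hz⟩
    obtain ⟨u, -, -, h⟩ := (hZm z).1 hz
    have h1 : ((z.val : ℤ) : ZMod N) = ((1 + t * u : ℤ) : ZMod N) := by
      rw [h]; simp
    rw [ZMod.intCast_eq_intCast_iff_dvd_sub] at h1
    have h2 : (t : ℤ) ∣ (1 + t * u) - z.val := (Dvd.intro _ hNz.symm).trans h1
    have h3 := (Dvd.intro u rfl : (t : ℤ) ∣ t * u).sub h2
    have e : (t : ℤ) * u - ((1 + t * u) - z.val) = z.val - 1 := by ring
    rwa [e] at h3
  have hent : ∀ z z' : Z, (H * (H.map (fun x => x ^ q))ᵀ) z z' =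
      if z.1 + (q : ZMod N) * z'.1 = 0 then (n : F) else 0 := by
    intro z z'
    rw [Matrix.mul_apply]
    have : ∀ j : Fin n, H z j * (H.map (fun x => x ^ q))ᵀ j z' =
        (η ^ (z.1.val + q * z'.1.val)) ^ (j : ℕ) := by
      intro j
      rw [Matrix.transpose_apply, Matrix.map_apply, hpow, hpow]
      ring
    rw [Finset.sum_congr rfl (fun j _ => this j),
      Fin.sum_univ_eq_sum_range (fun j => (η ^ (z.1.val + q * z'.1.val)) ^ j) n]
    have hiff : z.1 + (q : ZMod N) * z'.1 = 0 ↔ η ^ (z.1.val + q * z'.1.val) = 1 := by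
      rw [hη.pow_eq_one_iff_dvd, ← ZMod.natCast_eq_zero_iff]
      push_cast
      rw [ZMod.natCast_zmod_val, ZMod.natCast_zmod_val]
    split_ifs with h
    · rw [hiff.1 h]; simp
    · have hx := fun hh => h (hiff.2 hh)
      rw [geom_sum_eq hx, ← pow_mul]
      have : t ∣ z.1.val + q * z'.1.val := by
        have h1 := hval z
        have h2 := (hval z').mul_left (q : ℤ)
        have h3 : (t : ℤ) ∣ q + 1 := ⟨s, by rw [hqz]; ring⟩
        have h4 := (h1.add h2).add h3
        have e : ((z.1.val : ℤ) - 1) + q * (z'.1.val - 1) + (q + 1) =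
          ((z.1.val + q * z'.1.val : ℕ) : ℤ) := by push_cast; ring
        rw [e] at h4
        exact_mod_cast h4
      rw [(hη.pow_eq_one_iff_dvd _).2 (hn.symm.dvd.trans (Nat.mul_dvd_mul_right this n))]
      simp
  have hn0 : (n : F) ≠ 0 := by
    intro h
    have h1 : ((q ^ 2 : ℕ) : F) = 0 := by rw [← hF]; exact Nat.cast_card_eq_zero F
    rw [← hq21, ← hn] at h1
    push_cast at h1
    rw [h] at h1
    simp at h1
  apply rank16 t _ (n : F) hn0 (fun w => ⟨_, hmem w⟩) (fun w => ⟨_, hmem w.rev⟩)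
  · intro w w' h
    exact hinj _ _ (Subtype.ext_iff.1 h)
  · intro w w' h
    exact Fin.rev_injective (hinj _ _ (Subtype.ext_iff.1 h))
  · intro w
    rw [hent, if_pos (hcond' w)]
  · intro z z' h
    rw [hent, if_neg]
    intro h0
    obtain ⟨w, h1, h2⟩ := hcond z z' h0
    exact h ⟨w, Subtype.ext h1, Subtype.ext h2⟩
end

section
/- Let t ≥ 3 be an odd integer, let q be an odd prime power with t dividing q+1, set n = (q^2−1)/t and m = ((t−1)(q−1)−2)/(2t). Let F be a finite field with q^2 elements and let η ∈ F be a primitive (q^2−1)-th root of unity. Let δ₁ and δ₂ be integers with (t−1)(q+1)/(2t) ≤ δ₁ ≤ (t+1)(q+1)/(2t) − 2 and (t−1)(q+1)/(2t) ≤ δ₂ ≤ (t+1)(q+1)/(2t) − 2, and let Z = {(1 + t(m+i)) mod (q^2−1) : −δ₁ ≤ i ≤ δ₂}. Let C = {c ∈ F^n : for all z ∈ Z, Σ_{j=0}^{n−1} c_j·η^{z·j} = 0}. Then dim_F C = n − (δ₁+δ₂+1) and every nonzero codeword of C has Hamming weight at least δ₁+δ₂+2 (so C is an MDS code with parameters [n,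 n−δ₁−δ₂−1, δ₁+δ₂+2] over F). -/
lemma aux_indep {F : Type*} [Field F] {n k : ℕ} (x v : Fin n → F)
    (hx : Function.Injective x) (hv : ∀ j, v j ≠ 0) (c : Fin n → F)
    (hc : ∀ l : ℕ, l < k → ∑ j, c j * (v j * x j ^ l) = 0)
    (hs : {j : Fin n | c j ≠ 0}.ncard ≤ k) : c = 0 := by
  classical
  set S : Finset (Fin n) := Finset.univ.filter (fun j => c j ≠ 0) with hS
  have hcard : S.card ≤ k := by
    have : {j : Fin n | c j ≠ 0} = (S : Set (Fin n)) := by ext; simp [hS]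
    rwa [this, Set.ncard_coe_finset] at hs
  let e := S.equivFin.symm
  have h0 : (fun i : Fin S.card => c (e i) * v (e i)) = 0 := by
    apply Matrix.eq_zero_of_forall_pow_sum_mul_pow_eq_zero
      (f := fun i : Fin S.card => x (e i))
    · intro a b hab
      exact e.injective (Subtype.ext (hx hab))
    · intro l
      rw [← hc l (lt_of_lt_of_le l.2 hcard)]
      rw [e.sum_comp (fun s : S => c s * v s * x s ^ (l : ℕ))]
      rw [Finset.sum_coe_sort S (fun s => c s * v s * x s ^ (l : ℕ))]
      generalize (l : ℕ) = l'
      rw [hS, Finset.sum_filter]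
      apply Finset.sum_congr rfl
      intro j _
      by_cases h : c j = 0 <;> simp [h, mul_assoc]
  funext j
  by_contra h
  have hj : j ∈ S := by simpa [hS] using h
  have := congrFun h0 (e.symm ⟨j, hj⟩)
  simp only [Equiv.apply_symm_apply, Pi.zero_apply, mul_eq_zero] at this
  exact this.elim h (hv j)

lemma aux_main {F : Type*} [Field F] {n k : ℕ} (x v : Fin n → F)
    (hx : Function.Injective x) (hv : ∀ j, v j ≠ 0) (hk : k ≤ n)
    (C : Submodule F (Fin n → F))
    (hC : ∀ c, c ∈ C ↔ ∀ l : ℕ, l < k → ∑ j, c j * (v j * x j ^ l) = 0) :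
    Module.finrank F C = n - k ∧
    ∀ c ∈ C, c ≠ 0 → k + 1 ≤ {j : Fin n | c j ≠ 0}.ncard := by
  constructor
  · let φ : (Fin n → F) →ₗ[F] (Fin k → F) :=
      Matrix.mulVecLin (Matrix.of fun (l : Fin k) (j : Fin n) => v j * x j ^ (l : ℕ))
    have hφ : ∀ c l, φ c l = ∑ j, c j * (v j * x j ^ (l : ℕ)) := by
      intro c l
      simp [φ, Matrix.mulVec, dotProduct, mul_comm]
    have hker : LinearMap.ker φ = C := by
      ext c
      rw [LinearMap.mem_ker, hC]
      constructor
      · intro h l hl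
        rw [← hφ c ⟨l, hl⟩, h]; rfl
      · intro h
        funext l
        rw [hφ, h l l.2]; rfl
    let ψ : (Fin k → F) →ₗ[F] (Fin n → F) :=
      Function.ExtendByZero.linearMap F (Fin.castLE hk)
    have hψ : ∀ w, ψ w = Function.extend (Fin.castLE hk) w 0 := fun w => rfl
    have hinj : Function.Injective (φ ∘ₗ ψ) := by
      rw [← LinearMap.ker_eq_bot, LinearMap.ker_eq_bot']
      intro w hw
      have h0 : ψ w = 0 := by
        apply aux_indep (k := k) x v hx hv
        · intro l hl
          rw [← hφ _ ⟨l, hl⟩]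
          exact congrFun hw ⟨l, hl⟩
        · have hsub : {j : Fin n | ψ w j ≠ 0} ⊆ Set.range (Fin.castLE hk) := by
            intro j hj
            by_contra h
            apply hj
            rw [hψ, Function.extend_apply' _ _ _ h]; rfl
          refine (Set.ncard_le_ncard hsub (Set.toFinite _)).trans ?_
          rw [← Set.image_univ]
          refine (Set.ncard_image_le (Set.toFinite _)).trans ?_
          simp [Set.ncard_univ]
      funext i
      have := congrFun h0 (Fin.castLE hk i)
      rwa [hψ, (Fin.castLE_injective hk).extend_apply] at this
    have hsurj : Function.Surjective φ := by
      have := LinearMap.injective_iff_surjective.1 hinj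
      rw [LinearMap.coe_comp] at this
      exact this.of_comp
    have := LinearMap.finrank_range_add_finrank_ker φ
    rw [LinearMap.range_eq_top.2 hsurj, hker, finrank_top] at this
    simp at this
    omega
  · intro c hc hne
    by_contra h
    exact hne (aux_indep x v hx hv c ((hC c).1 hc) (by omega))

lemma aux_pow {F : Type*} [Field F] {N : ℕ} [NeZero N] {η : F} (hη : IsPrimitiveRoot η N)
    (a : ℤ) : η ^ ((a : ZMod N).val) = η ^ a := by
  have h1 : (((a : ZMod N).val : ℕ) : ℤ) = a % N := ZMod.val_intCast a
  have h0 : η ≠ 0 := hη.ne_zero (NeZero.ne N)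
  rw [← zpow_natCast, h1]
  conv_rhs => rw [← Int.emod_add_mul_ediv a N, zpow_add₀ h0, zpow_mul, zpow_natCast, hη.pow_eq_one]
  simp

/-- Let `t ≥ 3` be odd, `q` an odd prime power with `t ∣ q + 1`,
`n = (q² - 1)/t`, `m = ((t-1)(q-1) - 2)/(2t)`, `F` a finite field with `q²` elements, and
`η ∈ F` a primitive `(q² - 1)`-th root of unity.  Let `δ₁, δ₂` satisfy
`(t-1)(q+1)/(2t) ≤ δᵢ ≤ (t+1)(q+1)/(2t) - 2` and
`Z = {(1 + t(m+i)) mod (q² - 1) : -δ₁ ≤ i ≤ δ₂}`.  Let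
`C = {c ∈ Fⁿ : ∀ z ∈ Z, Σⱼ cⱼ·η^(z·j) = 0}`.  Then `dim_F C = n - (δ₁ + δ₂ + 1)` and
every nonzero codeword of `C` has Hamming weight at least `δ₁ + δ₂ + 2`. -/
theorem stmt17 (t q : ℕ) (ht3 : 3 ≤ t) (htodd : Odd t)
    (hq : IsPrimePow q) (hqodd : Odd q) (hdvd : t ∣ q + 1)
    (n : ℕ) (hn : t * n = q ^ 2 - 1)
    (m : ℤ) (hm : 2 * (t : ℤ) * m = ((t : ℤ) - 1) * ((q : ℤ) - 1) - 2)
    (F : Type*) [Field F] [Fintype F] (hF : Fintype.card F = q ^ 2)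
    (η : F) (hη : IsPrimitiveRoot η (q ^ 2 - 1))
    (δ₁ δ₂ : ℕ)
    (h11 : ((t : ℤ) - 1) * ((q : ℤ) + 1) / (2 * t) ≤ (δ₁ : ℤ))
    (h12 : (δ₁ : ℤ) ≤ ((t : ℤ) + 1) * ((q : ℤ) + 1) / (2 * t) - 2)
    (h21 : ((t : ℤ) - 1) * ((q : ℤ) + 1) / (2 * t) ≤ (δ₂ : ℤ))
    (h22 : (δ₂ : ℤ) ≤ ((t : ℤ) + 1) * ((q : ℤ) + 1) / (2 * t) - 2)
    (Z : Finset (ZMod (q ^ 2 - 1)))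
    (hZ : Z = (Finset.Icc (-(δ₁ : ℤ)) (δ₂ : ℤ)).image
      (fun (i : ℤ) => ((1 + t * (m + i) : ℤ) : ZMod (q ^ 2 - 1))))
    (C : Submodule F (Fin n → F))
    (hC : ∀ c, c ∈ C ↔ ∀ z ∈ Z,
      ∑ j : Fin n, c j * η ^ ((z * ((j : ℕ) : ZMod (q ^ 2 - 1))).val) = 0) :
    Module.finrank F C = n - (δ₁ + δ₂ + 1) ∧
    ∀ c ∈ C, c ≠ 0 → δ₁ + δ₂ + 2 ≤ {j : Fin n | c j ≠ 0}.ncard := by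
  have hq1 : 1 ≤ q := hq.one_lt.le
  have hkey : δ₁ + δ₂ + 1 ≤ n := by
    obtain ⟨s, hs⟩ := hdvd
    have hs2 : 2 ≤ s := by
      rcases s with _ | _ | s
      · omega
      · exfalso
        obtain ⟨a, ha⟩ := htodd
        obtain ⟨b, hb⟩ := hqodd
        omega
      · omega
    have hnZ : (n : ℤ) = s * (q - 1) := by
      have h1 : (t : ℤ) * n = q ^ 2 - 1 := by
        have : 1 ≤ q ^ 2 := Nat.one_le_pow _ _ hq1
        have := congrArg (Nat.cast : ℕ → ℤ) hn
        push_cast [Nat.cast_sub ‹1 ≤ q ^ 2›] at this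
        exact this
      have h2 : (q : ℤ) + 1 = t * s := by exact_mod_cast hs
      have ht0 : (t : ℤ) ≠ 0 := by positivity
      apply mul_left_cancel₀ ht0
      rw [h1]
      linear_combination ((q : ℤ) - 1) * h2
    have h2 : (q : ℤ) + 1 = t * s := by exact_mod_cast hs
    have ht0 : (0 : ℤ) < 2 * t := by positivity
    have hB : 2 * (((t : ℤ) + 1) * ((q : ℤ) + 1) / (2 * t)) ≤ (t + 1) * s := by
      have := Int.mul_ediv_self_le (x := ((t : ℤ) + 1) * ((q : ℤ) + 1)) (k := 2 * t) ht0.ne'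
      rw [h2] at this ⊢
      have ht1 : (0 : ℤ) < t := by positivity
      nlinarith
    have hs2' : (2 : ℤ) ≤ s := by exact_mod_cast hs2
    have ht3' : (3 : ℤ) ≤ t := by exact_mod_cast ht3
    have : (t : ℤ) + 1 ≤ q - 1 := by nlinarith
    have : ((t : ℤ) + 1) * s ≤ s * (q - 1) := by nlinarith
    zify
    linarith
  have hN : 0 < q ^ 2 - 1 := by
    have : 1 < q := hq.one_lt
    have : 1 < q ^ 2 := Nat.one_lt_pow (by norm_num) this
    omega
  haveI : NeZero (q ^ 2 - 1) := ⟨hN.ne'⟩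
  have h0 : η ≠ 0 := hη.ne_zero hN.ne'
  have ht0 : 0 < t := by omega
  apply aux_main (k := δ₁ + δ₂ + 1) (fun j : Fin n => η ^ (t * (j : ℕ)))
    (fun j : Fin n => η ^ ((1 + t * (m - δ₁)) * (j : ℤ)))
  · intro a b hab
    have := hη.pow_inj (by rw [← hn]; exact Nat.mul_lt_mul_of_pos_left a.2 ht0)
      (by rw [← hn]; exact Nat.mul_lt_mul_of_pos_left b.2 ht0) hab
    exact Fin.ext (Nat.eq_of_mul_eq_mul_left ht0 this)
  · intro j
    exact zpow_ne_zero _ h0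
  · exact hkey
  · intro c
    have hexp : ∀ (l : ℕ) (j : Fin n),
        η ^ ((((1 + t * (m + (-(δ₁ : ℤ) + l)) : ℤ) : ZMod (q ^ 2 - 1)) *
          ((j : ℕ) : ZMod (q ^ 2 - 1))).val)
        = η ^ ((1 + t * (m - δ₁)) * (j : ℤ)) * (η ^ (t * (j : ℕ))) ^ l := by
      intro l j
      have := aux_pow hη ((1 + t * (m + (-(δ₁ : ℤ) + l))) * ((j : ℕ) : ℤ))
      rw [Int.cast_mul, Int.cast_natCast] at this
      rw [this, ← pow_mul, ← zpow_natCast, ← zpow_add₀ h0]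
      congr 1
      push_cast
      ring
    rw [hC, hZ]
    constructor
    · intro h l hl
      have := h _ (Finset.mem_image_of_mem _
        (Finset.mem_Icc.2 (⟨by omega, by omega⟩ :
          -(δ₁ : ℤ) ≤ -(δ₁ : ℤ) + l ∧ -(δ₁ : ℤ) + l ≤ δ₂)))
      simp only [hexp] at this
      exact this
    · intro h z hz
      obtain ⟨i, hi, rfl⟩ := Finset.mem_image.1 hz
      rw [Finset.mem_Icc] at hi
      obtain ⟨l, hl⟩ := Int.eq_ofNat_of_zero_le (show 0 ≤ i + δ₁ by omega)
      obtain rfl : i = -(δ₁ : ℤ) + l := by omega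
      simp only [hexp]
      exact h l (by omega)
end

section
/- Let F be a field, let n be a positive integer whose image in F is nonzero, let α ∈ F be a primitive n-th root of unity, and let q be a positive integer. Let Z be a finite subset of ℤ/nℤ and let H be the matrix over F with rows indexed by Z and columns indexed by j ∈ {0,1,…,n−1}, whose (z,j) entry is α^{z·j}. Then the rank of H·H^{(q)T} equals the cardinality of Z ∩ {−q·z : z ∈ Z}, where H^{(q)T} denotes the transpose of the matrix obtained by raising every entry of H to the q-th power. -/
open Matrix

/-- Let `F` be a field, `n` a positive integer whose image in `F` is nonzero,
`α ∈ F` a primitive `n`-th root of unity, and `q` a positive integer.  Let `Z` be a finite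
subset of `ℤ/nℤ` and let `H` be the matrix with rows indexed by `Z` and columns by
`{0, …, n-1}` whose `(z, j)` entry is `α^(z·j)`.  Then the rank of `H·H^(q)ᵀ` (where
`H^(q)ᵀ` is the transpose of the entrywise `q`-th power of `H`) equals the cardinality of
`Z ∩ {-q·z : z ∈ Z}`. -/
theorem stmt18 (F : Type*) [Field F] (n : ℕ) (hn : 0 < n) (hnF : (n : F) ≠ 0)
    (α : F) (hα : IsPrimitiveRoot α n) (q : ℕ) (hq : 0 < q)
    (Z : Finset (ZMod n))
    (H : Matrix ↥Z (Fin n) F)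
    (hH : ∀ (z : ↥Z) (j : Fin n), H z j = α ^ ((z.1 * ((j : ℕ) : ZMod n)).val)) :
    (H * (H.map (fun x => x ^ q))ᵀ).rank =
      (Z ∩ Z.image (fun z => -(q : ZMod n) * z)).card := by
  classical
  haveI : NeZero n := ⟨hn.ne'⟩
  have hpow : ∀ (z : ↥Z) (j : Fin n), H z j = (α ^ z.1.val) ^ (j : ℕ) := by
    intro z j
    rw [hH, ← pow_mul, ZMod.val_mul, ZMod.val_natCast, ← pow_mod_orderOf α (z.1.val * j),
      ← hα.eq_orderOf, Nat.mul_mod_mod]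
  have hG : ∀ z w : ↥Z, (H * (H.map (fun x => x ^ q))ᵀ) z w =
      if z.1 = -(q : ZMod n) * w.1 then (n : F) else 0 := by
    intro z w
    have h1 : (H * (H.map (fun x => x ^ q))ᵀ) z w =
        ∑ j ∈ Finset.range n, (α ^ (z.1.val + q * w.1.val)) ^ j := by
      rw [Matrix.mul_apply, Finset.sum_range]
      refine Finset.sum_congr rfl fun j _ => ?_
      rw [Matrix.transpose_apply, Matrix.map_apply, hpow, hpow]
      ring
    have h2 : α ^ (z.1.val + q * w.1.val) = 1 ↔ z.1 = -(q : ZMod n) * w.1 := by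
      rw [hα.pow_eq_one_iff_dvd, ← ZMod.natCast_eq_zero_iff]
      push_cast
      rw [ZMod.natCast_zmod_val, ZMod.natCast_zmod_val, neg_mul, eq_neg_iff_add_eq_zero]
    rw [h1]
    split_ifs with h
    · rw [h2.2 h]; simp
    · have h3 : α ^ (z.1.val + q * w.1.val) ≠ 1 := fun h' => h (h2.1 h')
      rw [geom_sum_eq h3, ← pow_mul, mul_comm, pow_mul, hα.pow_eq_one]
      simp
  set G := H * (H.map (fun x => x ^ q))ᵀ with hGdef
  let S := {z : ↥Z // ∃ w : ↥Z, z.1 = -(q : ZMod n) * w.1}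
  let b : S → (↥Z → F) := fun z => Pi.single z.1 1
  have hb : LinearIndependent F b := by
    have := (Pi.basisFun F ↥Z).linearIndependent.comp (fun z : S => z.1) Subtype.val_injective
    convert this using 1
    ext z
    simp [b]
  have hcol : ∀ (z w : ↥Z), z.1 = -(q : ZMod n) * w.1 →
      G.col w = (n : F) • (Pi.single z 1 : ↥Z → F) := by
    intro z w h
    ext y
    rw [Matrix.col_apply, hG, ← h]
    by_cases hy : y = z
    · simp [hy]
    · have : y.1 ≠ z.1 := fun h' => hy (Subtype.ext h')
      simp [hy, this]
  have hspan : Submodule.span F (Set.range G.col) = Submodule.span F (Set.range b) := by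
    apply le_antisymm
    · rw [Submodule.span_le]
      rintro _ ⟨w, rfl⟩
      by_cases h : ∃ z : ↥Z, z.1 = -(q : ZMod n) * w.1
      · obtain ⟨z, hz⟩ := h
        rw [hcol z w hz]
        exact Submodule.smul_mem _ _ (Submodule.subset_span ⟨⟨z, w, hz⟩, rfl⟩)
      · have : G.col w = 0 := by
          ext y
          rw [Matrix.col_apply, hG, if_neg (fun h' => h ⟨y, h'⟩)]
          rfl
        rw [this]
        exact Submodule.zero_mem _
    · rw [Submodule.span_le]
      rintro _ ⟨⟨z, w, hz⟩, rfl⟩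
      have : b ⟨z, w, hz⟩ = (n : F)⁻¹ • G.col w := by
        rw [hcol z w hz, smul_smul, inv_mul_cancel₀ hnF, one_smul]
      rw [this]
      exact Submodule.smul_mem _ _ (Submodule.subset_span ⟨w, rfl⟩)
  rw [Matrix.rank_eq_finrank_span_cols, hspan, finrank_span_eq_card hb, ← Fintype.card_coe]
  refine Fintype.card_congr ⟨fun z => ⟨z.1.1, ?_⟩, fun z => ⟨⟨z.1, ?_⟩, ?_⟩, ?_, ?_⟩
  · obtain ⟨z, w, hz⟩ := z
    exact Finset.mem_inter.2 ⟨z.2, Finset.mem_image.2 ⟨w.1, w.2, hz.symm⟩⟩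
  · exact (Finset.mem_inter.1 z.2).1
  · obtain ⟨w, hw, h⟩ := Finset.mem_image.1 (Finset.mem_inter.1 z.2).2
    exact ⟨⟨w, hw⟩, h.symm⟩
  · intro z; rfl
  · intro z; rfl
end
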